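/- There exists an absolute constant γ₀ > 0 such that for every γ > γ₀ there is a constant R* with R(s_c) < R* < R(0) having the following property: every unidirectional solitary wave solution (ψ, η, r) has its Bernoulli constant in the range R(s_c) < r < R*. -/

import Mathlib

noncomputable section

open Real Set

/-- Partial derivative of `ψ` in the horizontal variable. -/
def px (ψ : ℝ → ℝ → ℝ) (x y : ℝ) : ℝ := deriv (fun t => ψ t y) x

/-- Partial derivative of `ψ` in the vertical variable. -/
def py (ψ : ℝ → ℝ → ℝ) (x y : ℝ) : ℝ := deriv (fun t => ψ x t) y

/-- Second partial derivative in `x`. -/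
def pxx (ψ : ℝ → ℝ → ℝ) (x y : ℝ) : ℝ := deriv (fun t => px ψ t y) x

/-- Second partial derivative in `y`. -/
def pyy (ψ : ℝ → ℝ → ℝ) (x y : ℝ) : ℝ := deriv (fun t => py ψ x t) y

/-- Depth `d(s)` of the laminar (stream) flow with surface value `s` of `ψ_y`. -/
def lamDepth (γ s : ℝ) : ℝ := (-s + Real.sqrt (s ^ 2 + 2 * γ)) / γ

/-- Bernoulli constant `R(s) = ½ s² + γ + d(s)` of the laminar flow. -/
def bernR (γ s : ℝ) : ℝ := s ^ 2 / 2 + γ + lamDepth γ s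

/-- `s` is the (unique) positive critical point `s_c` of `R`, characterized by the
equation `s - 1/γ + s/(γ √(s² + 2γ)) = 0`. -/
def IsCrit (γ s : ℝ) : Prop :=
  0 < s ∧ s - 1 / γ + s / (γ * Real.sqrt (s ^ 2 + 2 * γ)) = 0

/-- A solution `(ψ, η, r)` of the stream-function formulation with constant adverse
vorticity `ω = -γ`:  `Δψ = γ` in the fluid domain `D_η`, the Bernoulli condition on the
surface, `ψ = 1` on the surface and `ψ = 0` on the flat bottom. -/
structure StreamSolution (γ : ℝ) (ψ : ℝ → ℝ → ℝ) (η : ℝ → ℝ) (r : ℝ) : Prop where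
  eta_smooth : ContDiff ℝ (⊤ : ℕ∞) η
  eta_pos : ∀ x, 0 < η x
  psi_smooth : ContDiff ℝ (⊤ : ℕ∞) (fun p : ℝ × ℝ => ψ p.1 p.2)
  laplace : ∀ x y, 0 < y → y < η x → pxx ψ x y + pyy ψ x y = γ
  bernoulli : ∀ x, (px ψ x (η x)) ^ 2 / 2 + (py ψ x (η x)) ^ 2 / 2 + η x = r
  surface_val : ∀ x, ψ x (η x) = 1
  bottom_val : ∀ x, ψ x 0 = 0

/-- The flow is unidirectional: `ψ_y > 0` everywhere in the fluid domain `D_η`. -/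
def Unidirectional (ψ : ℝ → ℝ → ℝ) (η : ℝ → ℝ) : Prop :=
  ∀ x y, 0 < y → y < η x → 0 < py ψ x y

/-- A Stokes wave with half-period `Λ`: the solution is `2Λ`-periodic and even in `x`,
and the surface profile is strictly decreasing from the crest (`x = 0`) to the
trough (`x = Λ`).  Thus `η̂ = max η = η 0` and `η̌ = min η = η Λ`. -/
structure StokesWave (γ : ℝ) (ψ : ℝ → ℝ → ℝ) (η : ℝ → ℝ) (r Λ : ℝ) : Prop where
  sol : StreamSolution γ ψ η r
  lam_pos : 0 < Λ
  eta_periodic : ∀ x, η (x + 2 * Λ) = η x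
  eta_even : ∀ x, η (-x) = η x
  psi_periodic : ∀ x y, ψ (x + 2 * Λ) y = ψ x y
  psi_even : ∀ x y, ψ (-x) y = ψ x y
  eta_anti : StrictAntiOn η (Set.Icc 0 Λ)

/-- A solitary wave (relative to the critical value `sc = s_c` of `γ`): the solution is
even in `x`, the profile is strictly decreasing on `(0, ∞)` and non-constant, and the
flow converges to a supercritical laminar flow `(U(·; s), d(s))` with `s > s_c`,
`R(s) = r` as `|x| → ∞`.  The crest is at `x = 0`, `η̂ = η 0` and `η̌ = inf η = d(s)`. -/
structure SolitaryWave (γ sc : ℝ) (ψ : ℝ → ℝ → ℝ) (η : ℝ → ℝ) (r : ℝ) : Prop where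
  sol : StreamSolution γ ψ η r
  eta_even : ∀ x, η (-x) = η x
  psi_even : ∀ x y, ψ (-x) y = ψ x y
  eta_anti : StrictAntiOn η (Set.Ioi 0)
  nonconst : ∃ x₁ x₂, η x₁ ≠ η x₂
  asymptotic : ∃ s, sc < s ∧ bernR γ s = r ∧
    ∀ ε > 0, ∃ X : ℝ, ∀ x : ℝ, X ≤ |x| →
      |η x - lamDepth γ s| ≤ ε ∧
      ∀ y ∈ Set.Icc 0 (η x), |px ψ x y| + |py ψ x y - (γ * y + s)| ≤ ε

open Filter Topology

def Dx (u : ℝ × ℝ → ℝ) (p : ℝ × ℝ) : ℝ := fderiv ℝ u p (1, 0)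
def Dy (u : ℝ × ℝ → ℝ) (p : ℝ × ℝ) : ℝ := fderiv ℝ u p (0, 1)

lemma smooth_diff {u : ℝ × ℝ → ℝ} (hu : ContDiff ℝ (⊤ : ℕ∞) u) : Differentiable ℝ u :=
  hu.differentiable (by simp)

lemma Dx_smooth {u : ℝ × ℝ → ℝ} (hu : ContDiff ℝ (⊤ : ℕ∞) u) : ContDiff ℝ (⊤ : ℕ∞) (Dx u) := by
  unfold Dx
  exact (hu.fderiv_right (by simp)).clm_apply contDiff_const

lemma Dy_smooth {u : ℝ × ℝ → ℝ} (hu : ContDiff ℝ (⊤ : ℕ∞) u) : ContDiff ℝ (⊤ : ℕ∞) (Dy u) := by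
  unfold Dy
  exact (hu.fderiv_right (by simp)).clm_apply contDiff_const

lemma hasDerivAt_x {u : ℝ × ℝ → ℝ} (hu : Differentiable ℝ u) (x y : ℝ) :
    HasDerivAt (fun t => u (t, y)) (Dx u (x, y)) x := by
  have h1 : HasDerivAt (fun t : ℝ => (t, y)) ((1 : ℝ), (0 : ℝ)) x :=
    (hasDerivAt_id x).prodMk (hasDerivAt_const x y)
  exact (hu (x, y)).hasFDerivAt.comp_hasDerivAt x h1

lemma hasDerivAt_y {u : ℝ × ℝ → ℝ} (hu : Differentiable ℝ u) (x y : ℝ) :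
    HasDerivAt (fun t => u (x, t)) (Dy u (x, y)) y := by
  have h1 : HasDerivAt (fun t : ℝ => (x, t)) ((0 : ℝ), (1 : ℝ)) y :=
    (hasDerivAt_const y x).prodMk (hasDerivAt_id y)
  exact (hu (x, y)).hasFDerivAt.comp_hasDerivAt y h1

lemma fderiv_eq_D (u : ℝ × ℝ → ℝ) (p : ℝ × ℝ) (a b : ℝ) :
    fderiv ℝ u p (a, b) = a * Dx u p + b * Dy u p := by
  have : ((a, b) : ℝ × ℝ) = a • ((1 : ℝ), (0 : ℝ)) + b • ((0 : ℝ), (1 : ℝ)) := by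
    ext <;> simp
  rw [this, map_add, map_smul, map_smul]; rfl

/-- derivative along a curve -/
lemma hasDerivAt_curve {u : ℝ × ℝ → ℝ} (hu : Differentiable ℝ u) {a b : ℝ → ℝ} {a' b' t : ℝ}
    (ha : HasDerivAt a a' t) (hb : HasDerivAt b b' t) :
    HasDerivAt (fun t => u (a t, b t)) (a' * Dx u (a t, b t) + b' * Dy u (a t, b t)) t := by
  have h := (hu (a t, b t)).hasFDerivAt.comp_hasDerivAt t (ha.prodMk hb)
  rw [fderiv_eq_D] at h
  exact h

lemma Dxy_symm {u : ℝ × ℝ → ℝ} (hu : ContDiff ℝ (⊤ : ℕ∞) u) (p : ℝ × ℝ) :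
    Dy (Dx u) p = Dx (Dy u) p := by
  have hs : IsSymmSndFDerivAt ℝ u p :=
    (hu.contDiffAt (x := p)).isSymmSndFDerivAt (by simp; exact WithTop.coe_le_coe.mpr (le_top : (2:ℕ∞) ≤ ⊤))
  have hd : DifferentiableAt ℝ (fderiv ℝ u) p :=
    ((hu.fderiv_right (m := (⊤ : ℕ∞)) (by simp)).differentiable (by simp)) p
  have e1 : Dy (Dx u) p = fderiv ℝ (fderiv ℝ u) p (0,1) (1,0) := by
    unfold Dy Dx
    rw [fderiv_clm_apply hd (differentiableAt_const _)]; simp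
  have e2 : Dx (Dy u) p = fderiv ℝ (fderiv ℝ u) p (1,0) (0,1) := by
    unfold Dy Dx
    rw [fderiv_clm_apply hd (differentiableAt_const _)]; simp
  rw [e1, e2]; exact hs _ _

lemma Dx_of_hasDerivAt {u : ℝ × ℝ → ℝ} (hu : Differentiable ℝ u) {x y c : ℝ}
    (h : HasDerivAt (fun t => u (t, y)) c x) : Dx u (x, y) = c :=
  (hasDerivAt_x hu x y).unique h

lemma Dy_of_hasDerivAt {u : ℝ × ℝ → ℝ} (hu : Differentiable ℝ u) {x y c : ℝ}
    (h : HasDerivAt (fun t => u (x, t)) c y) : Dy u (x, y) = c :=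
  (hasDerivAt_y hu x y).unique h

/-- The rescaled solitary wave. -/
structure Wv (ε S D : ℝ) (u : ℝ × ℝ → ℝ) (η : ℝ → ℝ) : Prop where
  eps : 0 < ε
  Spos : 0 < S
  Dpos : 0 < D
  SD : D ^ 2 / 2 + S * D = 1
  eta_smooth : ContDiff ℝ (⊤ : ℕ∞) η
  eta_pos : ∀ x, 0 < η x
  u_smooth : ContDiff ℝ (⊤ : ℕ∞) u
  lap : ∀ x y, 0 < y → y < η x → Dx (Dx u) (x, y) + Dy (Dy u) (x, y) = 1
  bern : ∀ x, (Dx u (x, η x)) ^ 2 / 2 + (Dy u (x, η x)) ^ 2 / 2 + ε * η x = S ^ 2 / 2 + 1 + ε * D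
  surf : ∀ x, u (x, η x) = 1
  bot : ∀ x, u (x, 0) = 0
  eta_even : ∀ x, η (-x) = η x
  u_even : ∀ x y, u (-x, y) = u (x, y)
  anti : StrictAntiOn η (Set.Ioi 0)
  uni : ∀ x y, 0 < y → y < η x → 0 < Dy u (x, y)
  asym : ∀ e > 0, ∃ X : ℝ, ∀ x : ℝ, X ≤ |x| →
      |η x - D| ≤ e ∧ ∀ y ∈ Set.Icc 0 (η x), |Dx u (x, y)| + |Dy u (x, y) - (y + S)| ≤ e

namespace Wv
variable {ε S D : ℝ} {u : ℝ × ℝ → ℝ} {η : ℝ → ℝ}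

lemma u_diff (W : Wv ε S D u η) : Differentiable ℝ u := smooth_diff W.u_smooth
lemma eta_cont (W : Wv ε S D u η) : Continuous η := W.eta_smooth.continuous
lemma eta_diff (W : Wv ε S D u η) : Differentiable ℝ η := W.eta_smooth.differentiable (by simp)

lemma eta_abs (W : Wv ε S D u η) (x : ℝ) : η |x| = η x := by
  rcases abs_choice x with h | h <;> rw [h]
  exact W.eta_even x

lemma eta_gt_pos (W : Wv ε S D u η) {x : ℝ} (hx : 0 < x) : D < η x := by
  have h2 : η (x + 1) < η x := W.anti hx (by simp; linarith) (by linarith)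
  by_contra hcon
  push Not at hcon
  obtain ⟨X, hX⟩ := W.asym ((D - η (x+1))/2) (by linarith)
  have hm : η (max X (x+2)) < η (x+1) :=
    W.anti (by simp; linarith) (by simp; right; linarith) (by simp)
  have h3 := (hX (max X (x+2)) ((le_max_left _ _).trans (le_abs_self _))).1
  rw [abs_le] at h3
  linarith

lemma eta_antitone (W : Wv ε S D u η) : AntitoneOn η (Ici 0) := by
  intro a ha b hb hab
  rcases eq_or_lt_of_le hab with h | h
  · rw [h]
  rcases eq_or_lt_of_le (show (0:ℝ) ≤ a from ha) with h0 | h0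
  · have ht : Tendsto η (𝓝[>] a) (𝓝 (η a)) := W.eta_cont.continuousAt.mono_left nhdsWithin_le_nhds
    refine ge_of_tendsto ht ?_
    filter_upwards [Ioo_mem_nhdsGT h] with t ht
    exact (W.anti (show (0:ℝ) < t by rw [h0]; exact ht.1) (show (0:ℝ) < b by linarith) ht.2).le
  · exact (W.anti h0 (show (0:ℝ) < b by linarith) h).le

lemma eta_le (W : Wv ε S D u η) (x : ℝ) : η x ≤ η 0 := by
  rw [← W.eta_abs x]
  exact W.eta_antitone (by simp) (by simp) (abs_nonneg x)

lemma eta_gt (W : Wv ε S D u η) (x : ℝ) : D < η x := by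
  rcases eq_or_ne x 0 with h | h
  · rw [h]; exact (W.eta_gt_pos one_pos).trans_le (W.eta_le 1)
  · rw [← W.eta_abs x]; exact W.eta_gt_pos (abs_pos.mpr h)

lemma deriv_eta_nonpos (W : Wv ε S D u η) {x : ℝ} (hx : 0 < x) : deriv η x ≤ 0 := by
  have := W.anti.antitoneOn.derivWithin_nonpos (x := x)
  rwa [derivWithin_of_mem_nhds (Ioi_mem_nhds hx)] at this

lemma Dx_cont (W : Wv ε S D u η) : Continuous (Dx u) := (Dx_smooth W.u_smooth).continuous
lemma Dy_cont (W : Wv ε S D u η) : Continuous (Dy u) := (Dy_smooth W.u_smooth).continuous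

/-- Points of the closed fluid domain are limits of interior points on the same vertical. -/
lemma closed_of_open (W : Wv ε S D u η) {g : ℝ × ℝ → ℝ} (hg : Continuous g) {c : ℝ} (x : ℝ)
    (h : ∀ y, 0 < y → y < η x → c ≤ g (x, y)) {y : ℝ} (h0 : 0 ≤ y) (h1 : y ≤ η x) :
    c ≤ g (x, y) := by
  have hc : IsClosed {y : ℝ | c ≤ g (x, y)} := isClosed_le continuous_const (by fun_prop)
  have hcl : closure (Ioo 0 (η x)) ⊆ {y : ℝ | c ≤ g (x, y)} :=
    closure_minimal (fun y hy => h y hy.1 hy.2) hc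
  rw [closure_Ioo (W.eta_pos x).ne] at hcl
  exact hcl ⟨h0, h1⟩

lemma Dy_nonneg (W : Wv ε S D u η) {x y : ℝ} (h0 : 0 ≤ y) (h1 : y ≤ η x) : 0 ≤ Dy u (x, y) :=
  W.closed_of_open W.Dy_cont x (fun y a b => (W.uni x y a b).le) h0 h1

lemma lap_closed (W : Wv ε S D u η) {x y : ℝ} (h0 : 0 ≤ y) (h1 : y ≤ η x) :
    Dx (Dx u) (x, y) + Dy (Dy u) (x, y) = 1 := by
  have hc : Continuous (fun p => Dx (Dx u) p + Dy (Dy u) p) :=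
    ((Dx_smooth (Dx_smooth W.u_smooth)).continuous).add
      ((Dy_smooth (Dy_smooth W.u_smooth)).continuous)
  apply le_antisymm
  · have := W.closed_of_open (c := -1) hc.neg x (fun y a b => by
      simp only [Pi.neg_apply]; rw [W.lap x y a b]) h0 h1
    simp only [Pi.neg_apply] at this
    linarith
  · exact W.closed_of_open (c := 1) hc x (fun y a b => (W.lap x y a b).ge) h0 h1

lemma surf_rel (W : Wv ε S D u η) (x : ℝ) :
    Dx u (x, η x) = - (Dy u (x, η x) * deriv η x) := by
  have h := hasDerivAt_curve W.u_diff (hasDerivAt_id x) (W.eta_diff x).hasDerivAt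
  have h2 : (fun t => u (id t, η t)) = fun _ => 1 := by funext t; exact W.surf t
  rw [h2] at h
  have := h.unique (hasDerivAt_const x (1:ℝ))
  simp only [id] at this
  linarith

lemma Dx_bot (W : Wv ε S D u η) (x : ℝ) : Dx u (x, 0) = 0 := by
  apply Dx_of_hasDerivAt W.u_diff
  simp only [W.bot]; exact hasDerivAt_const _ _

lemma Dxx_bot (W : Wv ε S D u η) (x : ℝ) : Dx (Dx u) (x, 0) = 0 := by
  apply Dx_of_hasDerivAt (smooth_diff (Dx_smooth W.u_smooth))
  simp only [W.Dx_bot]; exact hasDerivAt_const _ _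

lemma Dx_odd (W : Wv ε S D u η) (x y : ℝ) : Dx u (-x, y) = - Dx u (x, y) := by
  have h := hasDerivAt_curve W.u_diff (hasDerivAt_neg x) (hasDerivAt_const x y)
  have h2 : (fun t => u (-t, y)) = fun t => u (t, y) := by funext t; exact W.u_even t y
  rw [h2] at h
  have := h.unique (hasDerivAt_x W.u_diff x y)
  linarith

lemma Dx_zero (W : Wv ε S D u η) (y : ℝ) : Dx u (0, y) = 0 := by
  have := W.Dx_odd 0 y
  simp at this; linarith

end Wv

/-- `ψ_y - y + i ψ_x` as a function of a complex variable -/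
def Fh (u : ℝ × ℝ → ℝ) (z : ℂ) : ℂ :=
  ((Dy u (z.re, z.im) - z.im : ℝ) : ℂ) + ((Dx u (z.re, z.im) : ℝ) : ℂ) * Complex.I

/-- Schwarz reflection of `Fh`. -/
def Gh (u : ℝ × ℝ → ℝ) (z : ℂ) : ℂ :=
  if 0 ≤ z.im then Fh u z else (starRingEnd ℂ) (Fh u ((starRingEnd ℂ) z))

lemma Fh_re (u : ℝ × ℝ → ℝ) (z : ℂ) : (Fh u z).re = Dy u (z.re, z.im) - z.im := by
  simp [Fh]
lemma Fh_im (u : ℝ × ℝ → ℝ) (z : ℂ) : (Fh u z).im = Dx u (z.re, z.im) := by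
  simp [Fh]

lemma Fh_hasFDerivAt {u : ℝ × ℝ → ℝ} (hu : ContDiff ℝ (⊤ : ℕ∞) u) (z : ℂ) :
    DifferentiableAt ℝ (Fh u) z ∧
    ∀ a b : ℝ, fderiv ℝ (Fh u) z ((a : ℂ) + (b : ℂ) * Complex.I) =
      ((a * Dx (Dy u) (z.re, z.im) + b * Dy (Dy u) (z.re, z.im) - b : ℝ) : ℂ)
      + ((a * Dx (Dx u) (z.re, z.im) + b * Dy (Dx u) (z.re, z.im) : ℝ) : ℂ) * Complex.I := by
  have e : HasFDerivAt (fun z : ℂ => (z.re, z.im))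
      ((Complex.reCLM).prod (Complex.imCLM)) z :=
    (Complex.reCLM.hasFDerivAt).prodMk (Complex.imCLM.hasFDerivAt)
  have h1 := ((smooth_diff (Dy_smooth hu)) (z.re, z.im)).hasFDerivAt.comp z e
  have h2 := ((smooth_diff (Dx_smooth hu)) (z.re, z.im)).hasFDerivAt.comp z e
  have h3 := (Complex.ofRealCLM.hasFDerivAt.comp z (h1.sub (Complex.imCLM.hasFDerivAt (x := z))))
  have h4 := (Complex.ofRealCLM.hasFDerivAt.comp z h2).mul_const Complex.I
  have h5 := h3.add h4
  have h6 : HasFDerivAt (Fh u) _ z := h5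
  refine ⟨h6.differentiableAt, fun a b => ?_⟩
  rw [h6.fderiv]
  simp [fderiv_eq_D]
  ring

lemma Fh_cont {u : ℝ × ℝ → ℝ} (hu : ContDiff ℝ (⊤ : ℕ∞) u) : Continuous (Fh u) :=
  continuous_iff_continuousAt.mpr fun z => (Fh_hasFDerivAt hu z).1.continuousAt

namespace Wv
variable {ε S D : ℝ} {u : ℝ × ℝ → ℝ} {η : ℝ → ℝ}

lemma Fh_holo (W : Wv ε S D u η) {z : ℂ} (h0 : 0 ≤ z.im) (h1 : z.im ≤ η z.re) :
    DifferentiableAt ℂ (Fh u) z := by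
  obtain ⟨hd, hf⟩ := Fh_hasFDerivAt W.u_smooth z
  rw [differentiableAt_complex_iff_differentiableAt_real]
  refine ⟨hd, ?_⟩
  have e1 := hf 1 0
  have e2 := hf 0 1
  simp only [Complex.ofReal_zero, Complex.ofReal_one, zero_add, one_mul, zero_mul, add_zero,
    sub_zero] at e1 e2
  rw [e1, e2]
  have hl := W.lap_closed h0 h1
  have hs := Dxy_symm W.u_smooth (z.re, z.im)
  have : Dy (Dy u) (z.re, z.im) - 1 = - Dx (Dx u) (z.re, z.im) := by linarith
  rw [this, hs]
  apply Complex.ext <;> simp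

lemma Fh_real (W : Wv ε S D u η) (x : ℝ) : (Fh u x).im = 0 := by
  rw [Fh_im]; simpa using W.Dx_bot x

lemma Fh_deriv_real (W : Wv ε S D u η) (x : ℝ) :
    ∃ c : ℝ, HasDerivAt (Fh u) (c : ℂ) (x : ℂ) := by
  have hd := W.Fh_holo (z := x) (by simp) (by simpa using (W.eta_pos x).le)
  refine ⟨Dx (Dy u) (x, 0), ?_⟩
  have h := hd.hasDerivAt
  have h2 : deriv (Fh u) (x:ℂ) = fderiv ℝ (Fh u) (x:ℂ) 1 := by
    rw [hd.fderiv_restrictScalars ℝ]; simp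
  have h3 := (Fh_hasFDerivAt W.u_smooth (x:ℂ)).2 1 0
  have h4 := W.Dxx_bot x
  simp [h4] at h3
  rwa [h2, h3] at h

lemma Gh_conj_of_nonpos (W : Wv ε S D u η) {z : ℂ} (h : z.im ≤ 0) :
    Gh u z = (starRingEnd ℂ) (Fh u ((starRingEnd ℂ) z)) := by
  unfold Gh
  split_ifs with h0
  · have h1 : z.im = 0 := le_antisymm h h0
    have hz : z = (z.re : ℂ) := by apply Complex.ext <;> simp [h1]
    rw [hz]
    simp only [Complex.conj_ofReal]
    rw [Complex.conj_eq_iff_im.mpr (W.Fh_real _)]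
  · rfl

lemma Gh_of_nonneg {z : ℂ} (h : 0 ≤ z.im) : Gh u z = Fh u z := if_pos h

lemma Gh_cont (W : Wv ε S D u η) : Continuous (Gh u) := by
  have hF := Fh_cont W.u_smooth
  unfold Gh
  refine Continuous.if_le hF (by
    exact Complex.continuous_conj.comp (hF.comp Complex.continuous_conj)) continuous_const
    Complex.continuous_im ?_
  intro z hz
  have := W.Gh_conj_of_nonpos (z := z) hz.ge
  rw [← this, Gh_of_nonneg hz.le]

lemma Gh_holo (W : Wv ε S D u η) {z : ℂ} (h : |z.im| < η z.re) :
    DifferentiableAt ℂ (Gh u) z := by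
  rw [abs_lt] at h
  rcases lt_trichotomy z.im 0 with h0 | h0 | h0
  · have hF := W.Fh_holo (z := (starRingEnd ℂ) z) (by simp; linarith) (by simp; linarith)
    have hF2 := hF.conj_conj
    simp only [Complex.conj_conj] at hF2
    refine hF2.congr_of_eventuallyEq ?_
    filter_upwards [(isOpen_lt Complex.continuous_im continuous_const).mem_nhds h0] with w hw
    exact W.Gh_conj_of_nonpos (le_of_lt hw)
  · have hz : z = (z.re : ℂ) := by apply Complex.ext <;> simp [h0]
    obtain ⟨c, hc⟩ := W.Fh_deriv_real z.re
    rw [← hz] at hc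
    have hcz : (starRingEnd ℂ) z = z := by rw [hz]; simp
    have hc2 := hc.conj_conj
    rw [hcz, Complex.conj_ofReal] at hc2
    have a1 : HasDerivWithinAt (Gh u) (c:ℂ) {w : ℂ | 0 ≤ w.im} z :=
      hc.hasDerivWithinAt.congr (fun w hw => Gh_of_nonneg hw) (Gh_of_nonneg h0.ge)
    have a2 : HasDerivWithinAt (Gh u) (c:ℂ) {w : ℂ | w.im ≤ 0} z :=
      hc2.hasDerivWithinAt.congr (fun w hw => W.Gh_conj_of_nonpos hw) (W.Gh_conj_of_nonpos h0.le)
    have a3 := a1.union a2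
    have : {w : ℂ | 0 ≤ w.im} ∪ {w : ℂ | w.im ≤ 0} = univ := by
      ext w; simp; exact le_total _ _
    rw [this, hasDerivWithinAt_univ] at a3
    exact a3.differentiableAt
  · refine (W.Fh_holo h0.le h.2.le).congr_of_eventuallyEq ?_
    filter_upwards [(isOpen_lt continuous_const Complex.continuous_im).mem_nhds h0] with w hw
    exact Gh_of_nonneg (le_of_lt hw)

lemma Gh_re (u : ℝ × ℝ → ℝ) (z : ℂ) : (Gh u z).re = Dy u (z.re, |z.im|) - |z.im| := by
  unfold Gh
  split_ifs with h
  · rw [Fh_re, abs_of_nonneg h]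
  · push Not at h
    simp only [Complex.conj_re, Fh_re, Complex.conj_im, abs_of_neg h]

end Wv

namespace Wv
variable {ε S D : ℝ} {u : ℝ × ℝ → ℝ} {η : ℝ → ℝ}

lemma surf_bound (W : Wv ε S D u η) (x : ℝ) : Dy u (x, η x) - η x ≤ S := by
  have h := W.bern x
  have h1 := W.eta_gt x
  have h2 := W.SD
  have h3 : (Dy u (x, η x)) ^ 2 ≤ (S + D) ^ 2 := by
    nlinarith [sq_nonneg (Dx u (x, η x)), mul_pos W.eps (sub_pos.mpr h1)]
  have h4 := abs_le_of_sq_le_sq' h3 (by linarith [W.Spos, W.Dpos])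
  linarith [h4.2]

lemma f_le (W : Wv ε S D u η) {x y : ℝ} (h0 : 0 ≤ y) (h1 : y ≤ η x) : Dy u (x, y) - y ≤ S := by
  apply le_of_forall_pos_le_add
  intro e he
  obtain ⟨X, hX⟩ := W.asym e he
  set X' := max X (|x| + 1) with hX'
  have hxX : |x| < X' := lt_of_lt_of_le (by linarith) (le_max_right _ _)
  set U : Set ℂ := {z | |z.re| < X' ∧ |z.im| < η z.re} with hU
  have hηc : Continuous fun z : ℂ => η z.re := W.eta_cont.comp Complex.continuous_re
  have hre : Continuous fun z : ℂ => |z.re| := Complex.continuous_re.abs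
  have him : Continuous fun z : ℂ => |z.im| := Complex.continuous_im.abs
  have hUo : IsOpen U := (isOpen_lt hre continuous_const).inter (isOpen_lt him hηc)
  have hUc : closure U ⊆ {z | |z.re| ≤ X' ∧ |z.im| ≤ η z.re} :=
    closure_minimal (fun z hz => ⟨hz.1.le, hz.2.le⟩)
      ((isClosed_le hre continuous_const).inter (isClosed_le him hηc))
  have hb : Bornology.IsBounded U := by
    refine (Metric.isBounded_iff_subset_closedBall 0).mpr ⟨X' + η 0, fun z hz => ?_⟩
    rw [mem_closedBall_zero_iff]
    have := Complex.norm_le_abs_re_add_abs_im z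
    linarith [hz.1, hz.2, W.eta_le z.re]
  have hd : DiffContOnCl ℂ (fun z => Complex.exp (Gh u z)) U :=
    ⟨fun z hz => (W.Gh_holo hz.2).cexp.differentiableWithinAt, (W.Gh_cont.cexp).continuousOn⟩
  have key : ∀ z ∈ frontier U, ‖Complex.exp (Gh u z)‖ ≤ Real.exp (S + e) := by
    intro z hz
    rw [hUo.frontier_eq] at hz
    have hc := hUc hz.1
    rw [Complex.norm_exp, Real.exp_le_exp, Gh_re]
    by_cases h2 : |z.im| < η z.re
    · have h3 : X' ≤ |z.re| := by
        by_contra hcon; push Not at hcon; exact hz.2 ⟨hcon, h2⟩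
      have h4 := (hX z.re ((le_max_left _ _).trans h3)).2 |z.im| ⟨abs_nonneg _, h2.le⟩
      have h5 := le_abs_self (Dy u (z.re, |z.im|) - (|z.im| + S))
      have h6 := abs_nonneg (Dx u (z.re, |z.im|))
      linarith
    · have h3 : |z.im| = η z.re := le_antisymm hc.2 (not_lt.mp h2)
      rw [h3]; linarith [W.surf_bound z.re]
  have hcl : (⟨x, y⟩ : ℂ) ∈ closure U := by
    rcases eq_or_lt_of_le h1 with h | h
    · -- boundary point: limit of points below
      have ht : Tendsto (fun t : ℝ => (⟨x, t⟩ : ℂ)) (𝓝[<] y) (𝓝 ⟨x, y⟩) := by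
        have : Continuous (fun t : ℝ => (⟨x, t⟩ : ℂ)) := by
          have : (fun t : ℝ => (⟨x, t⟩ : ℂ)) = fun t : ℝ => (x : ℂ) + t * Complex.I := by
            funext t; apply Complex.ext <;> simp
          rw [this]; fun_prop
        exact this.continuousAt.mono_left nhdsWithin_le_nhds
      refine mem_closure_of_tendsto ht ?_
      have hy : 0 < y := h ▸ W.eta_pos x
      filter_upwards [Ioo_mem_nhdsLT hy] with t ht
      refine ⟨hxX, ?_⟩
      simp only [abs_of_pos ht.1]; linarith [ht.2]
    · exact subset_closure ⟨hxX, by simpa [abs_of_nonneg h0] using h⟩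
  have hfin := Complex.norm_le_of_forall_mem_frontier_norm_le hb hd key hcl
  rw [Complex.norm_exp, Real.exp_le_exp, Gh_re] at hfin
  simpa [abs_of_nonneg h0] using hfin

lemma Dx_nonneg_int (W : Wv ε S D u η) {x y : ℝ} (hx : 0 < x) (h0 : 0 < y) (h1 : y < η x) :
    0 ≤ Dx u (x, y) := by
  apply le_of_forall_pos_le_add
  intro e he
  obtain ⟨X, hX⟩ := W.asym e he
  set X' := max X (x + 1) with hX'
  have hxX : x < X' := lt_of_lt_of_le (by linarith) (le_max_right _ _)
  set U : Set ℂ := {z | (0 < z.re ∧ z.re < X') ∧ (0 < z.im ∧ z.im < η z.re)} with hU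
  have hηc : Continuous fun z : ℂ => η z.re := W.eta_cont.comp Complex.continuous_re
  have hre := Complex.continuous_re
  have him := Complex.continuous_im
  have hUo : IsOpen U :=
    ((isOpen_lt continuous_const hre).inter (isOpen_lt hre continuous_const)).inter
    ((isOpen_lt continuous_const him).inter (isOpen_lt him hηc))
  have hUc : closure U ⊆ {z | (0 ≤ z.re ∧ z.re ≤ X') ∧ (0 ≤ z.im ∧ z.im ≤ η z.re)} :=
    closure_minimal (fun z hz => ⟨⟨hz.1.1.le, hz.1.2.le⟩, ⟨hz.2.1.le, hz.2.2.le⟩⟩)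
     (((isClosed_le continuous_const hre).inter (isClosed_le hre continuous_const)).inter
      ((isClosed_le continuous_const him).inter (isClosed_le him hηc)))
  have hb : Bornology.IsBounded U := by
    refine (Metric.isBounded_iff_subset_closedBall 0).mpr ⟨X' + η 0, fun z hz => ?_⟩
    rw [mem_closedBall_zero_iff]
    have := Complex.norm_le_abs_re_add_abs_im z
    rw [abs_of_pos hz.1.1, abs_of_pos hz.2.1] at this
    linarith [hz.1.2, hz.2.2, W.eta_le z.re]
  have hd : DiffContOnCl ℂ (fun z => Complex.exp (Complex.I * Fh u z)) U :=
    ⟨fun z hz => ((W.Fh_holo hz.2.1.le hz.2.2.le).const_mul _).cexp.differentiableWithinAt,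
      ((continuous_const.mul (Fh_cont W.u_smooth)).cexp).continuousOn⟩
  have nrm : ∀ z, ‖Complex.exp (Complex.I * Fh u z)‖ = Real.exp (- Dx u (z.re, z.im)) := by
    intro z
    rw [Complex.norm_exp, ← Fh_im]; simp
  have key : ∀ z ∈ frontier U, ‖Complex.exp (Complex.I * Fh u z)‖ ≤ Real.exp e := by
    intro z hz
    rw [hUo.frontier_eq] at hz
    have hc := hUc hz.1
    rw [nrm, Real.exp_le_exp]
    by_cases a1 : 0 < z.re
    swap
    · rw [le_antisymm (not_lt.mp a1) hc.1.1, W.Dx_zero]; linarith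
    by_cases a2 : 0 < z.im
    swap
    · rw [le_antisymm (not_lt.mp a2) hc.2.1, W.Dx_bot]; linarith
    by_cases a3 : z.im < η z.re
    swap
    · rw [le_antisymm hc.2.2 (not_lt.mp a3), W.surf_rel]
      nlinarith [W.deriv_eta_nonpos a1, W.Dy_nonneg (W.eta_pos z.re).le le_rfl]
    have a4 : X' ≤ z.re := by
      by_contra hcon; push Not at hcon; exact hz.2 ⟨⟨a1, hcon⟩, ⟨a2, a3⟩⟩
    have h4 := (hX z.re ((le_max_left _ _).trans (a4.trans (le_abs_self _)))).2 z.im ⟨a2.le, a3.le⟩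
    have h5 := neg_abs_le (Dx u (z.re, z.im))
    have h6 := abs_nonneg (Dy u (z.re, z.im) - (z.im + S))
    linarith
  have hcl : (⟨x, y⟩ : ℂ) ∈ closure U := subset_closure ⟨⟨hx, hxX⟩, ⟨h0, h1⟩⟩
  have hfin := Complex.norm_le_of_forall_mem_frontier_norm_le hb hd key hcl
  rw [nrm, Real.exp_le_exp] at hfin
  simp only at hfin
  linarith

lemma Dx_nonneg (W : Wv ε S D u η) {x y : ℝ} (hx : 0 ≤ x) (h0 : 0 ≤ y) (h1 : y ≤ η x) :
    0 ≤ Dx u (x, y) := by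
  rcases eq_or_lt_of_le hx with h | h
  · rw [← h, W.Dx_zero]
  · exact W.closed_of_open W.Dx_cont x (fun y a b => W.Dx_nonneg_int h a b) h0 h1

/-- Fact B: Harnack type bound near the bottom under the crest. -/
lemma factB (W : Wv ε S D u η) {y : ℝ} (h0 : 0 ≤ y) (h1 : y < D) :
    y - 2 * S * y / (D - y) ≤ Dy u (0, y) := by
  set f0 : ℝ := Dy u (0, 0) with hf0
  have hf0n : 0 ≤ f0 := W.Dy_nonneg le_rfl (W.eta_pos 0).le
  have hin : ∀ z ∈ Metric.ball (0:ℂ) D, |z.im| < η z.re := by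
    intro z hz
    rw [mem_ball_zero_iff] at hz
    linarith [Complex.abs_im_le_norm z, W.eta_gt z.re]
  have hd : DifferentiableOn ℂ (fun z => Gh u z - (f0 : ℂ)) (Metric.ball 0 D) := fun z hz =>
    ((W.Gh_holo (hin z hz)).sub_const _).differentiableWithinAt
  have hm : Set.MapsTo (fun z => Gh u z - (f0 : ℂ)) (Metric.ball 0 D) {z | z.re ≤ S} := by
    intro z hz
    have := W.f_le (abs_nonneg z.im) (hin z hz).le
    simp only [mem_setOf_eq, Complex.sub_re, Complex.ofReal_re, Gh_re]
    linarith
  have hz0 : Gh u 0 - (f0 : ℂ) = 0 := by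
    rw [Gh_of_nonneg (by simp)]
    have := W.Fh_real 0
    apply Complex.ext
    · simp [Fh_re, hf0]
    · simpa using this
  have hz : (⟨0, y⟩ : ℂ) ∈ Metric.ball (0:ℂ) D := by
    rw [mem_ball_zero_iff]
    refine lt_of_le_of_lt (Complex.norm_le_abs_re_add_abs_im _) ?_
    simpa [abs_of_nonneg h0] using h1
  have hn : ‖(⟨0, y⟩ : ℂ)‖ = y := by
    have : (⟨0, y⟩ : ℂ) = (y:ℂ) * Complex.I := by apply Complex.ext <;> simp
    rw [this]; simp [abs_of_nonneg h0]
  have h := Complex.borelCaratheodory_zero W.Spos hd hm W.Dpos hz hz0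
  rw [hn] at h
  have h2 := (abs_le.mp ((Complex.abs_re_le_norm _).trans h)).1
  simp only [Complex.sub_re, Complex.ofReal_re, Gh_re, abs_of_nonneg h0] at h2
  linarith

end Wv

lemma second_deriv_nonneg {f f' : ℝ → ℝ} {x c : ℝ} (hf : ∀ t, HasDerivAt f (f' t) t)
    (hf' : HasDerivAt f' c x) (hm : IsLocalMin f x) : 0 ≤ c := by
  by_contra hc
  push Not at hc
  have hdf : deriv f = f' := funext fun t => (hf t).deriv
  have h1 : IsLocalMax f x := by
    apply isLocalMax_of_deriv_deriv_neg
    · rw [hdf, hf'.deriv]; exact hc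
    · exact hm.deriv_eq_zero
    · exact (hf x).continuousAt
  have h2 : f =ᶠ[𝓝 x] fun _ => f x := by
    filter_upwards [hm, h1] with t a b
    exact le_antisymm b a
  have h3 : f' =ᶠ[𝓝 x] fun _ => 0 := by
    have := h2.deriv
    rw [hdf] at this
    simpa using this
  have h4 := h3.deriv_eq
  rw [hf'.deriv] at h4
  simp at h4
  linarith

lemma Dx_congr {f g : ℝ × ℝ → ℝ} {p : ℝ × ℝ} (h : f =ᶠ[𝓝 p] g) : Dx f p = Dx g p := by
  unfold Dx; rw [h.fderiv_eq]
lemma Dy_congr {f g : ℝ × ℝ → ℝ} {p : ℝ × ℝ} (h : f =ᶠ[𝓝 p] g) : Dy f p = Dy g p := by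
  unfold Dy; rw [h.fderiv_eq]

namespace Wv
variable {ε S D : ℝ} {u : ℝ × ℝ → ℝ} {η : ℝ → ℝ}

lemma u_le (W : Wv ε S D u η) {x y : ℝ} (h0 : 0 ≤ y) (h1 : y ≤ η x) :
    u (x, y) ≤ y ^ 2 / 2 + S * y := by
  have hd : ∀ t, HasDerivAt (fun t => u (x, t) - (t ^ 2 / 2 + S * t)) (Dy u (x, t) - (t + S)) t := by
    intro t
    have := (hasDerivAt_y W.u_diff x t).sub ((((hasDerivAt_id t).pow 2).div_const 2).add
      ((hasDerivAt_id t).const_mul S))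
    exact this.congr_deriv (by simp; try ring)
  have hanti : AntitoneOn (fun t => u (x, t) - (t ^ 2 / 2 + S * t)) (Icc 0 (η x)) := by
    apply antitoneOn_of_deriv_nonpos (convex_Icc _ _)
    · exact fun t _ => (hd t).continuousAt.continuousWithinAt
    · exact fun t _ => (hd t).differentiableAt.differentiableWithinAt
    · intro t ht
      rw [interior_Icc] at ht
      rw [(hd t).deriv]
      linarith [W.f_le (x := x) ht.1.le ht.2.le]
  have := hanti (left_mem_Icc.mpr (W.eta_pos x).le) ⟨h0, h1⟩ h0
  simp [W.bot] at this
  linarith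

def PF (u : ℝ × ℝ → ℝ) (p : ℝ × ℝ) : ℝ := ((Dx u p) ^ 2 + (Dy u p) ^ 2) / 2 - u p

lemma PF_smooth (W : Wv ε S D u η) : ContDiff ℝ (⊤ : ℕ∞) (PF u) := by
  unfold PF
  exact ((((Dx_smooth W.u_smooth).pow 2).add ((Dy_smooth W.u_smooth).pow 2)).div_const 2).sub
    W.u_smooth

lemma Dx_PF (W : Wv ε S D u η) (p : ℝ × ℝ) :
    Dx (PF u) p = Dx u p * Dx (Dx u) p + Dy u p * Dx (Dy u) p - Dx u p := by
  obtain ⟨x, y⟩ := p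
  apply Dx_of_hasDerivAt (smooth_diff W.PF_smooth)
  have h1 := hasDerivAt_x (smooth_diff (Dx_smooth W.u_smooth)) x y
  have h2 := hasDerivAt_x (smooth_diff (Dy_smooth W.u_smooth)) x y
  have := (((h1.pow 2).add (h2.pow 2)).div_const 2).sub (hasDerivAt_x W.u_diff x y)
  exact this.congr_deriv (by simp; try ring)

lemma Dy_PF (W : Wv ε S D u η) (p : ℝ × ℝ) :
    Dy (PF u) p = Dx u p * Dy (Dx u) p + Dy u p * Dy (Dy u) p - Dy u p := by
  obtain ⟨x, y⟩ := p
  apply Dy_of_hasDerivAt (smooth_diff W.PF_smooth)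
  have h1 := hasDerivAt_y (smooth_diff (Dx_smooth W.u_smooth)) x y
  have h2 := hasDerivAt_y (smooth_diff (Dy_smooth W.u_smooth)) x y
  have := (((h1.pow 2).add (h2.pow 2)).div_const 2).sub (hasDerivAt_y W.u_diff x y)
  exact this.congr_deriv (by simp; try ring)

lemma open_dom (W : Wv ε S D u η) : IsOpen {p : ℝ × ℝ | 0 < p.2 ∧ p.2 < η p.1} :=
  (isOpen_lt continuous_const continuous_snd).inter
    (isOpen_lt continuous_snd (W.eta_cont.comp continuous_fst))

lemma lap_ev (W : Wv ε S D u η) {x y : ℝ} (h0 : 0 < y) (h1 : y < η x) :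
    (fun p => Dx (Dx u) p) =ᶠ[𝓝 (x, y)] fun p => 1 - Dy (Dy u) p := by
  filter_upwards [W.open_dom.mem_nhds ⟨h0, h1⟩] with p hp
  have := W.lap p.1 p.2 hp.1 hp.2
  linarith

/-- The elliptic identity for the P-function. -/
lemma PF_ident (W : Wv ε S D u η) {x y : ℝ} (h0 : 0 < y) (h1 : y < η x) :
    ((Dx u (x, y)) ^ 2 + (Dy u (x, y)) ^ 2) *
      (Dx (Dx (PF u)) (x, y) + Dy (Dy (PF u)) (x, y)) =
    2 * ((Dx (Dx u) (x, y) * Dx u (x, y) + Dx (Dy u) (x, y) * Dy u (x, y)) * Dx (PF u) (x, y) +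
     (Dx (Dy u) (x, y) * Dx u (x, y) + Dy (Dy u) (x, y) * Dy u (x, y)) * Dy (PF u) (x, y)) := by
  have sx := Dx_smooth W.u_smooth
  have sy := Dy_smooth W.u_smooth
  have hl := W.lap x y h0 h1
  have hxx : Dx (Dx (PF u)) (x, y) = Dx (Dx u) (x, y) * Dx (Dx u) (x, y)
      + Dx u (x, y) * Dx (Dx (Dx u)) (x, y) + (Dx (Dy u) (x, y) * Dx (Dy u) (x, y)
      + Dy u (x, y) * Dx (Dx (Dy u)) (x, y)) - Dx (Dx u) (x, y) := by
    apply Dx_of_hasDerivAt (smooth_diff (Dx_smooth W.PF_smooth))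
    simp only [W.Dx_PF]
    exact (((hasDerivAt_x (smooth_diff sx) x y).mul
      (hasDerivAt_x (smooth_diff (Dx_smooth sx)) x y)).add
      ((hasDerivAt_x (smooth_diff sy) x y).mul
      (hasDerivAt_x (smooth_diff (Dx_smooth sy)) x y))).sub (hasDerivAt_x (smooth_diff sx) x y)
  have hyy : Dy (Dy (PF u)) (x, y) = Dy (Dx u) (x, y) * Dy (Dx u) (x, y)
      + Dx u (x, y) * Dy (Dy (Dx u)) (x, y) + (Dy (Dy u) (x, y) * Dy (Dy u) (x, y)
      + Dy u (x, y) * Dy (Dy (Dy u)) (x, y)) - Dy (Dy u) (x, y) := by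
    apply Dy_of_hasDerivAt (smooth_diff (Dy_smooth W.PF_smooth))
    simp only [W.Dy_PF]
    exact (((hasDerivAt_y (smooth_diff sx) x y).mul
      (hasDerivAt_y (smooth_diff (Dy_smooth sx)) x y)).add
      ((hasDerivAt_y (smooth_diff sy) x y).mul
      (hasDerivAt_y (smooth_diff (Dy_smooth sy)) x y))).sub (hasDerivAt_y (smooth_diff sy) x y)
  have sw : Dy (Dx u) = Dx (Dy u) := funext fun p => Dxy_symm W.u_smooth p
  -- third derivatives
  have t1 : Dx (Dx (Dx u)) (x, y) = - Dy (Dy (Dx u)) (x, y) := by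
    have e1 : Dx (Dx (Dx u)) (x, y) = Dx (fun p => 1 - Dy (Dy u) p) (x, y) :=
      Dx_congr (W.lap_ev h0 h1)
    have e2 : Dx (fun p => 1 - Dy (Dy u) p) (x, y) = - Dx (Dy (Dy u)) (x, y) := by
      apply Dx_of_hasDerivAt (smooth_diff (contDiff_const.sub (Dy_smooth sy)))
      simpa using (hasDerivAt_x (smooth_diff (Dy_smooth sy)) x y).const_sub 1
    rw [e1, e2, sw, ← Dxy_symm sy]
  have t2 : Dx (Dx (Dy u)) (x, y) = - Dy (Dy (Dy u)) (x, y) := by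
    have e1 : Dy (Dx (Dx u)) (x, y) = Dy (fun p => 1 - Dy (Dy u) p) (x, y) :=
      Dy_congr (W.lap_ev h0 h1)
    have e2 : Dy (fun p => 1 - Dy (Dy u) p) (x, y) = - Dy (Dy (Dy u)) (x, y) := by
      apply Dy_of_hasDerivAt (smooth_diff (contDiff_const.sub (Dy_smooth sy)))
      simpa using (hasDerivAt_y (smooth_diff (Dy_smooth sy)) x y).const_sub 1
    rw [← e2, ← e1, Dxy_symm sx, sw]
  rw [hxx, hyy, W.Dx_PF, W.Dy_PF, t1, t2, sw]
  have hc : Dx (Dx u) (x, y) = 1 - Dy (Dy u) (x, y) := by linarith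
  rw [hc]
  ring

lemma isCompact_dom (W : Wv ε S D u η) (X : ℝ) :
    IsCompact {p : ℝ × ℝ | |p.1| ≤ X ∧ 0 ≤ p.2 ∧ p.2 ≤ η p.1} := by
  have hc : IsClosed {p : ℝ × ℝ | |p.1| ≤ X ∧ 0 ≤ p.2 ∧ p.2 ≤ η p.1} :=
    (isClosed_le (continuous_abs.comp continuous_fst) continuous_const).inter
      ((isClosed_le continuous_const continuous_snd).inter
        (isClosed_le continuous_snd (W.eta_cont.comp continuous_fst)))
  refine ((isCompact_Icc (a := -X) (b := X)).prod
    (isCompact_Icc (a := (0:ℝ)) (b := η 0))).of_isClosed_subset hc ?_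
  intro p hp
  exact ⟨abs_le.mp hp.1, hp.2.1, hp.2.2.trans (W.eta_le _)⟩

lemma PF_surf (W : Wv ε S D u η) (x : ℝ) :
    PF u (x, η x) = S ^ 2 / 2 + ε * D - ε * η x := by
  unfold PF
  rw [W.surf]
  linarith [W.bern x]

/-- Fact C: minimum principle for the P-function. -/
lemma factC (W : Wv ε S D u η) (hH : S ^ 2 / 2 + ε * D - ε * η 0 ≤ 0) {x0 y0 : ℝ}
    (h0 : 0 ≤ y0) (h1 : y0 ≤ η x0) : S ^ 2 / 2 + ε * D - ε * η 0 ≤ PF u (x0, y0) := by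
  set m := S ^ 2 / 2 + ε * D - ε * η 0 with hm
  by_contra hcon
  push Not at hcon
  set κ := (m - PF u (x0, y0)) / 3 with hκ
  have hκ0 : 0 < κ := by rw [hκ]; linarith
  have hp0 : PF u (x0, y0) < m - 2 * κ := by rw [hκ]; linarith
  have hS := W.Spos
  have hD := W.Dpos
  -- boundary information
  have bsurf : ∀ x, m ≤ PF u (x, η x) := by
    intro x
    rw [W.PF_surf]
    have := mul_le_mul_of_nonneg_left (W.eta_le x) W.eps.le
    rw [hm]; linarith
  have bbot : ∀ x, m ≤ PF u (x, 0) := by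
    intro x
    unfold PF
    rw [W.bot]
    nlinarith [sq_nonneg (Dx u (x, 0)), sq_nonneg (Dy u (x, 0))]
  set e := min 1 (min (S / 2) (S ^ 2 / (2 * (D + 1 + S)))) with he
  have he0 : 0 < e := by rw [he]; positivity
  have he1 : e ≤ 1 := min_le_left _ _
  have he2 : e ≤ S / 2 := (min_le_right _ _).trans (min_le_left _ _)
  have he3 : e * (D + 1 + S) ≤ S ^ 2 / 2 := by
    have : e ≤ S ^ 2 / (2 * (D + 1 + S)) := (min_le_right _ _).trans (min_le_right _ _)
    rw [le_div_iff₀ (by positivity)] at this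
    linarith
  obtain ⟨X, hX⟩ := W.asym e he0
  have bfar : ∀ x y, X ≤ |x| → 0 ≤ y → y ≤ η x → m ≤ PF u (x, y) := by
    intro x y hx hy0 hy1
    obtain ⟨a1, a2⟩ := hX x hx
    have a3 := a2 y ⟨hy0, hy1⟩
    have a4 : |Dy u (x, y) - (y + S)| ≤ e := by linarith [abs_nonneg (Dx u (x, y))]
    rw [abs_le] at a1 a4
    have a5 := W.u_le hy0 hy1
    unfold PF
    have a6 : (y + S - e) ^ 2 ≤ (Dy u (x, y)) ^ 2 := by
      apply pow_le_pow_left₀ <;> linarith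
    have a7 : y ≤ D + 1 := by linarith
    nlinarith [sq_nonneg (Dx u (x, y)), mul_le_mul_of_nonneg_left a7 he0.le]
  set X' := max X |x0| with hX'
  set K := {p : ℝ × ℝ | |p.1| ≤ X' ∧ 0 ≤ p.2 ∧ p.2 ≤ η p.1} with hK
  have cK : IsCompact K := W.isCompact_dom X'
  have cP : Continuous (PF u) := W.PF_smooth.continuous
  have hp0K : (x0, y0) ∈ K := ⟨le_max_right _ _, h0, h1⟩
  -- interior property
  have hseg : ∀ p ∈ K, PF u p < m → |p.1| < X' ∧ 0 < p.2 ∧ p.2 < η p.1 := by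
    rintro ⟨x, y⟩ ⟨k1, k2, k3⟩ hlt
    refine ⟨lt_of_le_of_ne k1 ?_, lt_of_le_of_ne k2 ?_, lt_of_le_of_ne k3 ?_⟩
    · intro h
      have := bfar x y (by rw [show |x| = X' from h]; exact le_max_left _ _) k2 k3
      linarith
    · intro h
      simp only at h
      rw [← h] at hlt
      linarith [bbot x]
    · intro h
      simp only at h
      rw [h] at hlt
      linarith [bsurf x]
  set Z := K ∩ {p | PF u p ≤ m - κ} with hZ
  have cZ : IsCompact Z := cK.inter_right (isClosed_le cP continuous_const)
  have hZne : Z.Nonempty := ⟨(x0, y0), hp0K, by simp only [mem_ofPred_eq]; linarith⟩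
  have cx := W.Dx_cont
  have cy := W.Dy_cont
  have cxx := (Dx_smooth (Dx_smooth W.u_smooth)).continuous
  have cxy := (Dx_smooth (Dy_smooth W.u_smooth)).continuous
  obtain ⟨q, hqZ, hq⟩ := cZ.exists_isMinOn hZne
    (f := fun p => (Dx u p) ^ 2 + (Dy u p) ^ 2) (by fun_prop)
  set μ := (Dx u q) ^ 2 + (Dy u q) ^ 2 with hμ
  have hμ0 : 0 < μ := by
    have hi := hseg q hqZ.1 (by have : PF u q ≤ m - κ := hqZ.2
                                linarith)
    have := W.uni q.1 q.2 hi.2.1 hi.2.2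
    rw [hμ]; positivity
  obtain ⟨M, hM⟩ := cZ.exists_bound_of_continuousOn
    (f := fun p => 2 * (Dx (Dx u) p * Dx u p + Dx (Dy u) p * Dy u p)) (by fun_prop)
  have hM0 : 0 ≤ M := (norm_nonneg _).trans (hM q hqZ)
  set l := M / μ + 1 with hl
  have hl0 : 0 < l := by rw [hl]; positivity
  set δ := κ / exp (l * X') with hδ
  have hδ0 : 0 < δ := by rw [hδ]; positivity
  have hδe : ∀ p ∈ K, δ * exp (l * p.1) ≤ κ := by
    intro p hp
    have h2 : exp (l * p.1) ≤ exp (l * X') :=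
      exp_le_exp.mpr (mul_le_mul_of_nonneg_left ((le_abs_self _).trans hp.1) hl0.le)
    rw [hδ, div_mul_eq_mul_div, div_le_iff₀ (exp_pos _)]
    exact mul_le_mul_of_nonneg_left h2 hκ0.le
  obtain ⟨⟨x, y⟩, hpK, hp⟩ := cK.exists_isMinOn ⟨_, hp0K⟩
    (f := fun p => PF u p - δ * exp (l * p.1)) (by fun_prop)
  have hPp : PF u (x, y) < m - κ := by
    have h2 : PF u (x, y) - δ * exp (l * x) ≤ PF u (x0, y0) - δ * exp (l * x0) := hp hp0K
    have h3 := hδe _ hpK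
    simp only at h3
    have : 0 < δ * exp (l * x0) := by positivity
    linarith
  obtain ⟨i1, i2, i3⟩ := hseg _ hpK (by linarith)
  simp only at i1 i2 i3
  have hnhds : K ∈ 𝓝 (x, y) := by
    have ho : IsOpen ({p : ℝ × ℝ | |p.1| < X'} ∩ {p : ℝ × ℝ | 0 < p.2 ∧ p.2 < η p.1}) :=
      (isOpen_lt (continuous_abs.comp continuous_fst) continuous_const).inter W.open_dom
    refine mem_of_superset (ho.mem_nhds ⟨i1, i2, i3⟩) ?_
    rintro p ⟨a, b, c⟩
    exact ⟨le_of_lt a, b.le, c.le⟩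
  have hloc : IsLocalMin (fun p : ℝ × ℝ => PF u p - δ * exp (l * p.1)) (x, y) :=
    hp.isLocalMin hnhds
  have lx : IsLocalMin (fun t => PF u (t, y) - δ * exp (l * t)) x := by
    have ht : Tendsto (fun t : ℝ => (t, y)) (𝓝 x) (𝓝 (x, y)) :=
      (Continuous.prodMk_left y).tendsto x
    exact ht.eventually hloc
  have ly : IsLocalMin (fun t => PF u (x, t) - δ * exp (l * x)) y := by
    have ht : Tendsto (fun t : ℝ => (x, t)) (𝓝 y) (𝓝 (x, y)) :=
      (Continuous.prodMk_right x).tendsto y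
    exact ht.eventually hloc
  have sP := W.PF_smooth
  have hex : ∀ t, HasDerivAt (fun t => exp (l * t)) (l * exp (l * t)) t := by
    intro t
    have := ((hasDerivAt_id t).const_mul l).exp
    simpa [mul_comm] using this
  have dx1 : ∀ t, HasDerivAt (fun t => PF u (t, y) - δ * exp (l * t))
      (Dx (PF u) (t, y) - δ * (l * exp (l * t))) t := fun t =>
    (hasDerivAt_x (smooth_diff sP) t y).sub ((hex t).const_mul δ)
  have dx2 : HasDerivAt (fun t => Dx (PF u) (t, y) - δ * (l * exp (l * t)))
      (Dx (Dx (PF u)) (x, y) - δ * (l * (l * exp (l * x)))) x :=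
    (hasDerivAt_x (smooth_diff (Dx_smooth sP)) x y).sub (((hex x).const_mul l).const_mul δ)
  have dy1 : ∀ t, HasDerivAt (fun t => PF u (x, t) - δ * exp (l * x)) (Dy (PF u) (x, t)) t :=
    fun t => (hasDerivAt_y (smooth_diff sP) x t).sub_const _
  have dy2 : HasDerivAt (fun t => Dy (PF u) (x, t)) (Dy (Dy (PF u)) (x, y)) y :=
    hasDerivAt_y (smooth_diff (Dy_smooth sP)) x y
  have r1 := lx.hasDerivAt_eq_zero (dx1 x)
  have r2 := ly.hasDerivAt_eq_zero (dy1 y)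
  have r3 := second_deriv_nonneg dx1 dx2 lx
  have r4 := second_deriv_nonneg dy1 dy2 ly
  have hid := W.PF_ident i2 i3
  have hpZ : (x, y) ∈ Z := ⟨hpK, hPp.le⟩
  have hb := hM _ hpZ
  have hb2 : μ ≤ (Dx u (x, y)) ^ 2 + (Dy u (x, y)) ^ 2 := hq hpZ
  rw [Real.norm_eq_abs] at hb
  have hb3 := (le_abs_self _).trans hb
  rw [r2] at hid
  have r1' : Dx (PF u) (x, y) = δ * (l * exp (l * x)) := by linarith
  rw [r1'] at hid
  set E := δ * (l * exp (l * x)) with hE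
  have hE0 : 0 < E := by rw [hE]; positivity
  have k1 : μ * (l * E) ≤ ((Dx u (x, y)) ^ 2 + (Dy u (x, y)) ^ 2) *
      (Dx (Dx (PF u)) (x, y) + Dy (Dy (PF u)) (x, y)) := by
    apply mul_le_mul hb2 _ (by positivity) (by positivity)
    have : l * E = δ * (l * (l * exp (l * x))) := by rw [hE]; ring
    linarith
  have k2 : μ * (l * E) ≤ M * E := by
    rw [hid] at k1
    have := mul_le_mul_of_nonneg_right hb3 hE0.le
    linarith
  have k3 : μ * l = M + μ := by rw [hl]; field_simp
  have k4 : μ * (l * E) = M * E + μ * E := by rw [← mul_assoc, k3]; ring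
  have : 0 < μ * E := by positivity
  linarith

end Wv

lemma hasDerivAt_param {G : ℝ × ℝ → ℝ} (hG : ContDiff ℝ (⊤ : ℕ∞) G) (a b x : ℝ) :
    HasDerivAt (fun x => ∫ t in a..b, G (x, t)) (∫ t in a..b, Dx G (x, t)) x := by
  have cG : Continuous G := hG.continuous
  have cD : Continuous (Dx G) := (Dx_smooth hG).continuous
  obtain ⟨M, hM⟩ := ((isCompact_Icc (a := x - 1) (b := x + 1)).prod
    (isCompact_uIcc (a := a) (b := b))).exists_bound_of_continuousOn (f := Dx G) cD.continuousOn
  refine (intervalIntegral.hasDerivAt_integral_of_dominated_loc_of_deriv_le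
    (F := fun x t => G (x, t)) (F' := fun x t => Dx G (x, t)) (s := Icc (x - 1) (x + 1))
    (bound := fun _ => M) (Icc_mem_nhds (by linarith) (by linarith)) ?_ ?_ ?_ ?_ ?_ ?_).2
  · exact Eventually.of_forall fun x => Continuous.aestronglyMeasurable (by fun_prop)
  · exact Continuous.intervalIntegrable (by fun_prop) _ _
  · exact Continuous.aestronglyMeasurable (by fun_prop)
  · refine Eventually.of_forall fun t ht z hz => hM (z, t) ⟨hz, uIoc_subset_uIcc ht⟩
  · exact intervalIntegrable_const
  · exact Eventually.of_forall fun t ht z hz => hasDerivAt_x (smooth_diff hG) z t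

namespace Wv
variable {ε S D : ℝ} {u : ℝ × ℝ → ℝ} {η : ℝ → ℝ}

def FF (ε S D : ℝ) (u : ℝ × ℝ → ℝ) (p : ℝ × ℝ) : ℝ :=
  ((Dy u p) ^ 2 - (Dx u p) ^ 2) / 2 + u p + (S ^ 2 / 2 + ε * D) - ε * p.2

lemma FF_smooth (W : Wv ε S D u η) : ContDiff ℝ (⊤ : ℕ∞) (FF ε S D u) := by
  unfold FF
  exact ((((((Dy_smooth W.u_smooth).pow 2).sub ((Dx_smooth W.u_smooth).pow 2)).div_const 2).add
    W.u_smooth).add contDiff_const).sub (contDiff_const.mul contDiff_snd)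

lemma FF_cont (W : Wv ε S D u η) : Continuous (FF ε S D u) := W.FF_smooth.continuous

def UV (u : ℝ × ℝ → ℝ) (p : ℝ × ℝ) : ℝ := Dx u p * Dy u p

lemma UV_smooth (W : Wv ε S D u η) : ContDiff ℝ (⊤ : ℕ∞) (UV u) :=
  (Dx_smooth W.u_smooth).mul (Dy_smooth W.u_smooth)

lemma Dx_FF (W : Wv ε S D u η) {x y : ℝ} (h0 : 0 ≤ y) (h1 : y ≤ η x) :
    Dx (FF ε S D u) (x, y) = Dy (UV u) (x, y) := by
  have sx := smooth_diff (Dx_smooth W.u_smooth)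
  have sy := smooth_diff (Dy_smooth W.u_smooth)
  have e1 : Dx (FF ε S D u) (x, y) = Dy u (x, y) * Dx (Dy u) (x, y)
      - Dx u (x, y) * Dx (Dx u) (x, y) + Dx u (x, y) := by
    apply Dx_of_hasDerivAt (smooth_diff W.FF_smooth)
    have := (((((hasDerivAt_x sy x y).pow 2).sub ((hasDerivAt_x sx x y).pow 2)).div_const 2).add
      (hasDerivAt_x W.u_diff x y)).add_const (S ^ 2 / 2 + ε * D) |>.sub_const (ε * y)
    exact this.congr_deriv (by simp; ring)
  have e2 : Dy (UV u) (x, y) = Dy (Dx u) (x, y) * Dy u (x, y)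
      + Dx u (x, y) * Dy (Dy u) (x, y) := by
    apply Dy_of_hasDerivAt (smooth_diff W.UV_smooth)
    exact (hasDerivAt_y sx x y).mul (hasDerivAt_y sy x y)
  have hl := W.lap_closed h0 h1
  have hc : Dx (Dx u) (x, y) = 1 - Dy (Dy u) (x, y) := by linarith
  rw [e1, e2, hc, Dxy_symm W.u_smooth]
  ring

lemma UV_bot (W : Wv ε S D u η) (x : ℝ) : UV u (x, 0) = 0 := by
  unfold UV; rw [W.Dx_bot, zero_mul]

lemma FF_surf (W : Wv ε S D u η) (x : ℝ) : FF ε S D u (x, η x) = (Dy u (x, η x)) ^ 2 := by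
  unfold FF
  have := W.bern x
  rw [W.surf]
  simp only
  linarith

/-- Derivative of the partial flow force. -/
lemma part_deriv (W : Wv ε S D u η) {x b : ℝ} (hb : 0 ≤ b) (h1 : b ≤ η x) :
    HasDerivAt (fun x => ∫ t in (0:ℝ)..b, FF ε S D u (x, t)) (UV u (x, b)) x := by
  refine (hasDerivAt_param W.FF_smooth 0 b x).congr_deriv ?_
  have e : ∫ t in (0:ℝ)..b, Dx (FF ε S D u) (x, t) = ∫ t in (0:ℝ)..b, Dy (UV u) (x, t) := by
    apply intervalIntegral.integral_congr
    intro t ht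
    rw [uIcc_of_le hb] at ht
    exact W.Dx_FF ht.1 (ht.2.trans h1)
  rw [e, intervalIntegral.integral_eq_sub_of_hasDerivAt (f := fun t => UV u (x, t))
    (fun t _ => hasDerivAt_y (smooth_diff W.UV_smooth) x t)
    (Continuous.intervalIntegrable
      (by have := (Dy_smooth W.UV_smooth).continuous; fun_prop) _ _)]
  rw [W.UV_bot, sub_zero]

def flow (ε S D : ℝ) (u : ℝ × ℝ → ℝ) (η : ℝ → ℝ) (x : ℝ) : ℝ := ∫ y in (0:ℝ)..(η x), FF ε S D u (x, y)

lemma flow_scaled (x : ℝ) :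
    flow ε S D u η x = ∫ t in (0:ℝ)..1, η x * FF ε S D u (x, η x * t) := by
  rw [intervalIntegral.integral_const_mul,
    intervalIntegral.mul_integral_comp_mul_left (f := fun y => FF ε S D u (x, y))]
  simp [flow]

lemma flow_deriv (W : Wv ε S D u η) (x : ℝ) : HasDerivAt (flow ε S D u η) 0 x := by
  have hfun : flow ε S D u η = fun x => ∫ t in (0:ℝ)..1,
      (fun p : ℝ × ℝ => η p.1 * FF ε S D u (p.1, η p.1 * p.2)) (x, t) :=
    funext fun x => flow_scaled x
  have sη : ContDiff ℝ (⊤ : ℕ∞) (fun p : ℝ × ℝ => η p.1) := W.eta_smooth.comp contDiff_fst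
  have sG : ContDiff ℝ (⊤ : ℕ∞) (fun p : ℝ × ℝ => η p.1 * FF ε S D u (p.1, η p.1 * p.2)) :=
    sη.mul (W.FF_smooth.comp (contDiff_fst.prodMk (sη.mul contDiff_snd)))
  rw [hfun]
  refine (hasDerivAt_param sG 0 1 x).congr_deriv ?_
  have hη := (W.eta_diff x).hasDerivAt
  have key : ∀ t ∈ Icc (0:ℝ) 1,
      Dx (fun p : ℝ × ℝ => η p.1 * FF ε S D u (p.1, η p.1 * p.2)) (x, t) =
      deriv η x * FF ε S D u (x, η x * t) + deriv η x * t * (η x * Dy (FF ε S D u) (x, η x * t))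
      + η x * Dy (UV u) (x, η x * t) := by
    intro t ht
    apply Dx_of_hasDerivAt (smooth_diff sG)
    have h1 := hasDerivAt_curve (smooth_diff W.FF_smooth) (hasDerivAt_id x) (hη.mul_const t)
    have h2 := hη.mul h1
    refine h2.congr_deriv ?_
    have := W.eta_pos x
    simp only [id]
    rw [W.Dx_FF (mul_nonneg this.le ht.1) (by nlinarith [ht.2])]
    ring
  have hanti : ∀ t : ℝ, HasDerivAt
      (fun t => deriv η x * t * FF ε S D u (x, η x * t) + UV u (x, η x * t))
      (deriv η x * FF ε S D u (x, η x * t) + deriv η x * t * (η x * Dy (FF ε S D u) (x, η x * t))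
      + η x * Dy (UV u) (x, η x * t)) t := by
    intro t
    have hb : HasDerivAt (fun t => η x * t) (η x) t := by
      simpa using (hasDerivAt_id t).const_mul (η x)
    have h1 := hasDerivAt_curve (smooth_diff W.FF_smooth) (hasDerivAt_const t x) hb
    have h2 := hasDerivAt_curve (smooth_diff W.UV_smooth) (hasDerivAt_const t x) hb
    have hc : HasDerivAt (fun t => deriv η x * t) (deriv η x) t := by
      simpa using (hasDerivAt_id t).const_mul (deriv η x)
    exact ((hc.mul h1).add h2).congr_deriv (by ring)
  have e : ∫ t in (0:ℝ)..1, Dx (fun p : ℝ × ℝ => η p.1 * FF ε S D u (p.1, η p.1 * p.2)) (x, t) =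
      ∫ t in (0:ℝ)..1, (deriv η x * FF ε S D u (x, η x * t)
       + deriv η x * t * (η x * Dy (FF ε S D u) (x, η x * t)) + η x * Dy (UV u) (x, η x * t)) := by
    apply intervalIntegral.integral_congr
    intro t ht
    rw [uIcc_of_le zero_le_one] at ht
    exact key t ht
  rw [e, intervalIntegral.integral_eq_sub_of_hasDerivAt (fun t _ => hanti t)
    (Continuous.intervalIntegrable
      (by have := (Dy_smooth W.UV_smooth).continuous
          have := (Dy_smooth W.FF_smooth).continuous
          have := W.FF_cont
          fun_prop) _ _)]
  simp only [mul_one, mul_zero, zero_mul]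
  rw [W.UV_bot, W.FF_surf]
  unfold UV
  rw [W.surf_rel]
  ring

lemma flow_const (W : Wv ε S D u η) (x y : ℝ) : flow ε S D u η x = flow ε S D u η y :=
  is_const_of_deriv_eq_zero (fun x => (W.flow_deriv x).differentiableAt)
    (fun x => (W.flow_deriv x).deriv) x y

def polyF (ε S D h : ℝ) : ℝ :=
  h ^ 3 / 3 + S * h ^ 2 + S ^ 2 * h / 2 + (S ^ 2 / 2 + ε * D) * h - ε * h ^ 2 / 2

lemma flow_le_poly (W : Wv ε S D u η) (x : ℝ) : flow ε S D u η x ≤ polyF ε S D (η x) := by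
  have hd : ∀ t : ℝ, HasDerivAt (polyF ε S D)
      ((t + S) ^ 2 / 2 + (t ^ 2 / 2 + S * t) + (S ^ 2 / 2 + ε * D) - ε * t) t := by
    intro t
    have h1 := hasDerivAt_id t
    have := (((((h1.pow 3).div_const 3).add ((h1.pow 2).const_mul S)).add
      ((h1.const_mul (S ^ 2)).div_const 2)).add (h1.const_mul (S ^ 2 / 2 + ε * D))).sub
      (((h1.pow 2).const_mul ε).div_const 2)
    exact this.congr_deriv (by simp; ring)
  have hi := intervalIntegral.integral_eq_sub_of_hasDerivAt (a := 0) (b := η x)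
    (fun t _ => hd t) (Continuous.intervalIntegrable (by fun_prop) _ _)
  have h0 : polyF ε S D 0 = 0 := by simp [polyF]
  rw [h0, sub_zero] at hi
  rw [← hi]
  unfold flow
  apply intervalIntegral.integral_mono_on (W.eta_pos x).le
  · exact Continuous.intervalIntegrable (by have := W.FF_cont; fun_prop) _ _
  · exact Continuous.intervalIntegrable (by fun_prop) _ _
  · intro y hy
    have a1 := W.u_le hy.1 hy.2
    have a2 := W.f_le hy.1 hy.2
    have a3 := W.Dy_nonneg hy.1 hy.2
    have a4 : (Dy u (x, y)) ^ 2 ≤ (y + S) ^ 2 := pow_le_pow_left₀ a3 (by linarith) 2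
    unfold FF
    simp only
    nlinarith [sq_nonneg (Dx u (x, y))]

lemma eta_tendsto (W : Wv ε S D u η) : Tendsto η atTop (𝓝 D) := by
  rw [Metric.tendsto_atTop]
  intro e he
  obtain ⟨X, hX⟩ := W.asym (e / 2) (by linarith)
  refine ⟨X, fun x hx => ?_⟩
  have := (hX x (hx.trans (le_abs_self x))).1
  rw [Real.dist_eq]; linarith

lemma flow_le (W : Wv ε S D u η) (x : ℝ) : flow ε S D u η x ≤ polyF ε S D D := by
  have hc : Continuous (polyF ε S D) := by unfold polyF; fun_prop
  have ht : Tendsto (fun z => polyF ε S D (η z)) atTop (𝓝 (polyF ε S D D)) :=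
    (hc.tendsto D).comp W.eta_tendsto
  refine ge_of_tendsto ht (Eventually.of_forall fun z => ?_)
  rw [W.flow_const x z]
  exact W.flow_le_poly z

/-- Fact A: the flow force inequality on the crest line. -/
lemma factA (W : Wv ε S D u η) {b : ℝ} (hb : D < b) (hb1 : b ≤ η 0) :
    (∫ y in (0:ℝ)..b, ((Dy u (0, y)) ^ 2 / 2 + u (0, y))) + (S ^ 2 / 2 + ε * D) * b - ε * b ^ 2 / 2
      ≤ polyF ε S D D := by
  have hD := W.Dpos
  have hb0 : 0 ≤ b := by linarith
  obtain ⟨X, hX0, hX⟩ : ∃ X, 0 ≤ X ∧ η X < b := by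
    have := (W.eta_tendsto.eventually (gt_mem_nhds hb)).and (eventually_ge_atTop (0:ℝ))
    obtain ⟨X, h1, h2⟩ := this.exists
    exact ⟨X, h2, h1⟩
  obtain ⟨ξ, hξ, hξb⟩ := intermediate_value_Icc' hX0 W.eta_cont.continuousOn
    (show b ∈ Icc (η X) (η 0) from ⟨hX.le, hb1⟩)
  have hge : ∀ x ∈ Icc 0 ξ, b ≤ η x := by
    intro x hx
    rw [← hξb]
    exact W.eta_antitone hx.1 hξ.1 hx.2
  have hmono : MonotoneOn (fun x => ∫ t in (0:ℝ)..b, FF ε S D u (x, t)) (Icc 0 ξ) := by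
    apply monotoneOn_of_deriv_nonneg (convex_Icc _ _)
    · exact fun t ht => (W.part_deriv hb0 (hge t ht)).continuousAt.continuousWithinAt
    · intro t ht
      rw [interior_Icc] at ht
      exact (W.part_deriv hb0 (hge t ⟨ht.1.le, ht.2.le⟩)).differentiableAt.differentiableWithinAt
    · intro t ht
      rw [interior_Icc] at ht
      have hg := hge t ⟨ht.1.le, ht.2.le⟩
      rw [(W.part_deriv hb0 hg).deriv]
      exact mul_nonneg (W.Dx_nonneg ht.1.le hb0 hg) (W.Dy_nonneg hb0 hg)
  have h1 := hmono (left_mem_Icc.mpr hξ.1) (right_mem_Icc.mpr hξ.1) hξ.1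
  simp only at h1
  have h2 : ∫ t in (0:ℝ)..b, FF ε S D u (ξ, t) = flow ε S D u η ξ := by
    unfold flow; rw [hξb]
  rw [h2] at h1
  have h3 := h1.trans (W.flow_le ξ)
  refine le_trans (le_of_eq ?_) h3
  have e : ∀ t, FF ε S D u (0, t) = ((Dy u (0, t)) ^ 2 / 2 + u (0, t)) +
      ((S ^ 2 / 2 + ε * D) - ε * t) := by
    intro t; unfold FF; rw [W.Dx_zero]; ring
  simp only [e]
  have c1 := W.Dy_cont
  have c2 := W.u_smooth.continuous
  symm
  rw [intervalIntegral.integral_add (Continuous.intervalIntegrable (by fun_prop) _ _)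
    (Continuous.intervalIntegrable (by fun_prop) _ _),
    intervalIntegral.integral_sub (Continuous.intervalIntegrable (by fun_prop) _ _)
    (Continuous.intervalIntegrable (by fun_prop) _ _), intervalIntegral.integral_const_mul, integral_id, intervalIntegral.integral_const]
  simp only [smul_eq_mul]
  ring

end Wv

lemma energy_identity {ε S D h : ℝ} (hD : 0 < D) (hh : 0 < h) (hSD : D ^ 2 / 2 + S * D = 1) :
    (-h ^ 3 / 24 + h / 2 + 1 / (2 * h)) + (S ^ 2 / 2 + ε * D) * h - ε * h ^ 2 / 2
      - Wv.polyF ε S D D = (h - D) ^ 2 / 2 * (1 / (h * D ^ 2) - (h + 2 * D) / 12 - ε) := by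
  have hS : S = 1 / D - D / 2 := by field_simp; linarith
  subst hS
  unfold Wv.polyF
  field_simp
  ring

lemma energy_neg {ε S D h : ℝ} (hD : 0 < D) (hh : D < h) (hSD : D ^ 2 / 2 + S * D = 1)
    (hle : (-h ^ 3 / 24 + h / 2 + 1 / (2 * h)) + (S ^ 2 / 2 + ε * D) * h - ε * h ^ 2 / 2
      ≤ Wv.polyF ε S D D) : 12 - h * D ^ 2 * (h + 2 * D) - 12 * ε * h * D ^ 2 ≤ 0 := by
  have hh0 : 0 < h := hD.trans hh
  have hid := energy_identity (ε := ε) hD hh0 hSD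
  have h1 : (h - D) ^ 2 / 2 * (1 / (h * D ^ 2) - (h + 2 * D) / 12 - ε) ≤ 0 := by linarith
  have h2 : 0 < (h - D) ^ 2 / 2 := by
    have : 0 < h - D := by linarith
    positivity
  have h3 : 1 / (h * D ^ 2) - (h + 2 * D) / 12 - ε ≤ 0 := by
    by_contra hc
    push Not at hc
    linarith [mul_pos h2 hc]
  have h4 : 12 - h * D ^ 2 * (h + 2 * D) - 12 * ε * h * D ^ 2 =
      (12 * h * D ^ 2) * (1 / (h * D ^ 2) - (h + 2 * D) / 12 - ε) := by
    field_simp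
  rw [h4]
  exact mul_nonpos_of_nonneg_of_nonpos (by positivity) h3

/-- lower bound at `h = √2`. -/
lemma sqrt_two_lower {ε S D q : ℝ} (hS : 0 < S) (hD : 0 < D)
    (hq : 0 < q) (hq2 : q ^ 2 = 2) (hSD : D ^ 2 / 2 + S * D = 1) :
    D * (12 * S + 2 * S * D ^ 2 - 12 * ε * q * D) ≤
      12 - q * D ^ 2 * (q + 2 * D) - 12 * ε * q * D ^ 2 := by
  have hDq : D ≤ q := by
    by_contra hc
    push Not at hc
    nlinarith [mul_pos hS hD]
  have h1 : q * D ≤ 2 - S * D := by nlinarith [sq_nonneg (q - D)]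
  have h2 : D ^ 2 * (q * D) ≤ D ^ 2 * (2 - S * D) := mul_le_mul_of_nonneg_left h1 (by positivity)
  nlinarith

lemma sqrt_two_pos {ε S D q : ℝ} (hε : 0 < ε) (hS : 1.9 * ε ≤ S) (hD : 0 < D)
    (hq : 0 < q) (hq2 : q ^ 2 = 2) (hSD : D ^ 2 / 2 + S * D = 1) :
    0 < 12 - q * D ^ 2 * (q + 2 * D) - 12 * ε * q * D ^ 2 := by
  have hS0 : 0 < S := by linarith
  refine lt_of_lt_of_le ?_ (sqrt_two_lower (ε := ε) hS0 hD hq hq2 hSD)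
  apply mul_pos hD
  have h1 : q * D ≤ 1 + D ^ 2 / 2 := by nlinarith [sq_nonneg (q - D)]
  have h2 : D ^ 2 < 2 := by nlinarith [mul_pos hS0 hD]
  have h3 : ε * (q * D) ≤ S / 1.9 * (1 + D ^ 2 / 2) := by
    apply mul_le_mul _ h1 (by positivity) (by positivity)
    rw [le_div_iff₀ (by norm_num)]; linarith
  have h4 : 12 * (S / 1.9 * (1 + D ^ 2 / 2)) < 12 * S + 2 * S * D ^ 2 := by
    have h5 : 0 < S * (2 - D ^ 2) := mul_pos hS0 (by linarith)
    have h6 : S / 1.9 = 10 / 19 * S := by norm_num; ring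
    rw [h6]
    nlinarith
  nlinarith

lemma le_of_sq_le_sq' {a b : ℝ} (h : a ^ 2 ≤ b ^ 2) (hb : 0 ≤ b) : a ≤ b :=
  (abs_le_of_sq_le_sq' h hb).2

section oneD
variable {g g' : ℝ → ℝ}

lemma tonelli (hg : ∀ y, HasDerivAt g (g' y) y) (hc : Continuous g') (σ : ℝ) {a b : ℝ}
    (hab : a ≤ b) :
    (b + σ) * g b - (a + σ) * g a - ((b + σ) ^ 3 - (a + σ) ^ 3) / 6 ≤
      ∫ y in a..b, ((g' y) ^ 2 / 2 + g y) := by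
  have hgc : Continuous g := continuous_iff_continuousAt.mpr fun y => (hg y).continuousAt
  have hd : ∀ t, HasDerivAt (fun y => (y + σ) * g y - (y + σ) ^ 3 / 6)
      (g t + (t + σ) * g' t - (t + σ) ^ 2 / 2) t := by
    intro t
    have h1 := (hasDerivAt_id t).add_const σ
    have := (h1.mul (hg t)).sub ((h1.pow 3).div_const 6)
    exact this.congr_deriv (by simp; ring)
  have hi := intervalIntegral.integral_eq_sub_of_hasDerivAt (a := a) (b := b)
    (fun t _ => hd t) (Continuous.intervalIntegrable (by fun_prop) _ _)
  have hm : (∫ y in a..b, (g y + (y + σ) * g' y - (y + σ) ^ 2 / 2)) ≤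
      ∫ y in a..b, ((g' y) ^ 2 / 2 + g y) := by
    apply intervalIntegral.integral_mono_on hab
    · exact Continuous.intervalIntegrable (by fun_prop) _ _
    · exact Continuous.intervalIntegrable (by fun_prop) _ _
    · intro y _
      nlinarith [sq_nonneg (g' y - (y + σ))]
  rw [hi] at hm
  linarith

lemma g_mono (hg : ∀ y, HasDerivAt g (g' y) y) {H : ℝ} (hp : ∀ y ∈ Icc 0 H, 0 ≤ g' y) :
    MonotoneOn g (Icc 0 H) := by
  apply monotoneOn_of_deriv_nonneg (convex_Icc _ _)
  · exact fun t ht => (hg t).continuousAt.continuousWithinAt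
  · exact fun t ht => (hg t).differentiableAt.differentiableWithinAt
  · intro t ht
    rw [(hg t).deriv]
    exact hp t (interior_subset ht)

/-- Comparison: once `g > Q`, the first integral forces fast growth. -/
lemma growth (hg : ∀ y, HasDerivAt g (g' y) y) {H Q y2 : ℝ} (hp : ∀ y ∈ Icc 0 H, 0 ≤ g' y)
    (hC : ∀ y ∈ Icc 0 H, g y - Q ≤ (g' y) ^ 2 / 2) (h0 : 0 ≤ y2) (h1 : y2 ≤ H)
    (hQ : Q < g y2) : H - y2 ≤ √(2 * (g H - Q)) - √(2 * (g y2 - Q)) := by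
  have hsub : ∀ y ∈ Icc y2 H, y ∈ Icc 0 H := fun y hy => ⟨h0.trans hy.1, hy.2⟩
  have hgt : ∀ y ∈ Icc y2 H, 0 < 2 * (g y - Q) := by
    intro y hy
    have := g_mono hg hp (hsub y2 ⟨le_rfl, h1⟩) (hsub y hy) hy.1
    linarith
  have hd : ∀ y ∈ Icc y2 H, HasDerivAt (fun y => √(2 * (g y - Q)) - y)
      ((2 * g' y) / (2 * √(2 * (g y - Q))) - 1) y := by
    intro y hy
    exact ((((hg y).sub_const Q).const_mul 2).sqrt (hgt y hy).ne').sub (hasDerivAt_id y)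
  have hmono : MonotoneOn (fun y => √(2 * (g y - Q)) - y) (Icc y2 H) := by
    apply monotoneOn_of_deriv_nonneg (convex_Icc _ _)
    · exact fun t ht => (hd t ht).continuousAt.continuousWithinAt
    · exact fun t ht => (hd t (interior_subset ht)).differentiableAt.differentiableWithinAt
    · intro t ht
      have ht' := interior_subset ht
      rw [(hd t ht').deriv]
      have hs : 0 < √(2 * (g t - Q)) := sqrt_pos.mpr (hgt t ht')
      have : √(2 * (g t - Q)) ≤ g' t := by
        apply sqrt_le_iff.mpr ⟨hp t (hsub t ht'), _⟩
        linarith [hC t (hsub t ht')]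
      rw [sub_nonneg, le_div_iff₀ (by positivity)]
      linarith
  have := hmono (left_mem_Icc.mpr h1) (right_mem_Icc.mpr h1) h1
  simp only at this
  linarith

lemma growth2 (hg : ∀ y, HasDerivAt g (g' y) y) {H Q y2 S q : ℝ}
    (hp : ∀ y ∈ Icc 0 H, 0 ≤ g' y) (hgH : g H = 1)
    (hC : ∀ y ∈ Icc 0 H, g y - Q ≤ (g' y) ^ 2 / 2) (h0 : 0 < y2) (h1 : y2 ≤ H)
    (hQ0 : 0 ≤ Q) (hS : 0 ≤ S) (hq : 0 < q) (hq2 : q ^ 2 = 2)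
    (hB : (1 - 10 * S) * y2 ^ 2 / 2 ≤ g y2)
    (hz : 10 * S * y2 ^ 2 + 2 * Q < y2 ^ 2) : H - q ≤ 10 * S * y2 + 2 * Q / y2 := by
  have hgr := growth hg hp hC h0.le h1 (by linarith)
  rw [hgH] at hgr
  have a1 : √(2 * (1 - Q)) ≤ q := sqrt_le_iff.mpr ⟨hq.le, by linarith⟩
  set z := 10 * S * y2 ^ 2 + 2 * Q with hzd
  have hz0 : 0 ≤ z := by rw [hzd]; positivity
  have a2 : y2 - z / y2 ≤ √(2 * (g y2 - Q)) := by
    apply le_sqrt_of_sq_le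
    have e1 : (y2 - z / y2) ^ 2 = y2 ^ 2 - 2 * z + z * (z / y2 ^ 2) := by field_simp; ring
    have e2 : z / y2 ^ 2 ≤ 1 := by rw [div_le_one (by positivity)]; exact hz.le
    have e3 := mul_le_mul_of_nonneg_left e2 hz0
    rw [e1]
    linarith
  have a3 : z / y2 = 10 * S * y2 + 2 * Q / y2 := by rw [hzd]; field_simp
  linarith

set_option maxHeartbeats 2000000 in
/-- The one-dimensional contradiction. -/
lemma endgame (hg : ∀ y, HasDerivAt g (g' y) y) (hc : Continuous g') {ε S D H q : ℝ}
    (hε : 0 < ε) (hε1 : ε ≤ 0.000000000001) (hS : 1.9 * ε ≤ S) (hD : 0 < D) (hSD : D ^ 2 / 2 + S * D = 1)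
    (hq : 0 < q) (hq2 : q ^ 2 = 2)
    (hDH : D < H) (hp : ∀ y ∈ Icc 0 H, 0 ≤ g' y) (g0 : g 0 = 0) (gH : g H = 1)
    (hA : ∀ b, D < b → b ≤ H → (∫ y in (0:ℝ)..b, ((g' y) ^ 2 / 2 + g y))
      + (S ^ 2 / 2 + ε * D) * b - ε * b ^ 2 / 2 ≤ Wv.polyF ε S D D)
    (hB : ∀ y, 0 ≤ y → y < D → y - 2 * S * y / (D - y) ≤ g' y)
    (hC : S ^ 2 / 2 + ε * D - ε * H ≤ 0 →
      ∀ y ∈ Icc 0 H, S ^ 2 / 2 + ε * D - ε * H + g y ≤ (g' y) ^ 2 / 2)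
    (hQ1 : ε * H - (S ^ 2 / 2 + ε * D) ≤ 1) : False := by
  have hgc : Continuous g := continuous_iff_continuousAt.mpr fun y => (hg y).continuousAt
  have hS0 : 0 < S := by linarith
  have hH0 : 0 < H := hD.trans hDH
  have hgm := g_mono hg hp
  have hgn : ∀ y ∈ Icc 0 H, 0 ≤ g y := by
    intro y hy
    have := hgm (left_mem_Icc.mpr hH0.le) hy hy.1
    rwa [g0] at this
  have hseg : ∀ a b, 0 ≤ a → a ≤ b → b ≤ H → 0 ≤ ∫ y in a..b, ((g' y) ^ 2 / 2 + g y) := by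
    intro a b ha hab hb
    apply intervalIntegral.integral_nonneg hab
    intro y hy
    have := hgn y ⟨ha.trans hy.1, hy.2.trans hb⟩
    positivity
  have hsplit : ∀ a b, (∫ y in (0:ℝ)..a, ((g' y) ^ 2 / 2 + g y)) +
      (∫ y in a..b, ((g' y) ^ 2 / 2 + g y)) = ∫ y in (0:ℝ)..b, ((g' y) ^ 2 / 2 + g y) := by
    intro a b
    apply intervalIntegral.integral_add_adjacent_intervals <;>
      exact Continuous.intervalIntegrable (by fun_prop) _ _
  have hDq : D < q := by
    by_contra hcon
    push Not at hcon
    nlinarith [mul_pos hS0 hD]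
  have hAH := hA H hDH le_rfl
  -- N1
  have N1 : 12 - H * D ^ 2 * (H + 2 * D) - 12 * ε * H * D ^ 2 ≤ 0 := by
    apply energy_neg hD hDH hSD
    have ht := tonelli hg hc (1 / H - H / 2) hH0.le
    rw [g0, gH] at ht
    have e : (H + (1 / H - H / 2)) * 1 - (0 + (1 / H - H / 2)) * 0 -
        ((H + (1 / H - H / 2)) ^ 3 - (0 + (1 / H - H / 2)) ^ 3) / 6 =
        -H ^ 3 / 24 + H / 2 + 1 / (2 * H) := by field_simp; ring
    rw [e] at ht
    linarith
  have L1 := sqrt_two_pos hε hS hD hq hq2 hSD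
  -- Step 1
  have hHq : q < H := by
    by_contra hcon
    push Not at hcon
    have h1 : H * D ^ 2 * (H + 2 * D) ≤ q * D ^ 2 * (q + 2 * D) := by gcongr
    have h2 : 12 * ε * H * D ^ 2 ≤ 12 * ε * q * D ^ 2 := by gcongr
    linarith
  -- Step 2
  have hKH : S ^ 2 / 2 + ε * D < ε * H := by
    by_contra hcon
    push Not at hcon
    have ht := tonelli hg hc (-(H - q)) (show H - q ≤ H by linarith)
    have hi := hseg 0 (H - q) le_rfl (by linarith) (by linarith)
    have hs := hsplit (H - q) H
    rw [gH] at ht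
    have e : (H + -(H - q)) * 1 - (H - q + -(H - q)) * g (H - q) -
        ((H + -(H - q)) ^ 3 - (H - q + -(H - q)) ^ 3) / 6 = 2 * q / 3 := by
      have : q ^ 3 = 2 * q := by rw [pow_succ, hq2]
      ring_nf; rw [this]; ring
    rw [e] at ht
    have h3 : 0 ≤ (H - q) * ((S ^ 2 / 2 + ε * D) - ε * (H + q) / 2) := by
      apply mul_nonneg (by linarith)
      nlinarith
    have e2 : -q ^ 3 / 24 + q / 2 + 1 / (2 * q) = 2 * q / 3 := by
      have e3 : q ^ 3 = 2 * q := by rw [pow_succ, hq2]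
      have e4 : 1 / (2 * q) = q / 4 := by
        rw [div_eq_div_iff (by positivity) (by norm_num)]; nlinarith
      rw [e4]; linarith
    have := energy_neg (ε := ε) hD hDq hSD (by rw [e2]; nlinarith)
    linarith
  -- Y
  obtain ⟨Y, hY⟩ : ∃ Y, Y = D + S ^ 2 / (2 * ε) := ⟨_, rfl⟩
  have hYε : ε * Y = S ^ 2 / 2 + ε * D := by rw [hY]; field_simp; ring
  have hYD : D < Y := by rw [hY]; have : 0 < S ^ 2 / (2 * ε) := by positivity
                         linarith
  have hYH : Y < H := by
    rw [← hYε] at hKH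
    exact lt_of_mul_lt_mul_left hKH hε.le
  have hSDle : S * D ≤ 1 := by have := sq_nonneg D; linarith
  have hD2 : D ^ 2 < 2 := by have := mul_pos hS0 hD; linarith
  have hDle : D < 1.4143 := lt_of_pow_lt_pow_left₀ 2 (by norm_num) (hD2.trans_le (by norm_num))
  have hpoly : Wv.polyF ε S D D = D - D ^ 3 / 6 + S / 2 * (1 - D ^ 2 / 2) + ε * Y * D - ε * D ^ 2 / 2 := by
    unfold Wv.polyF
    rw [hYε]
    have h1 : S * D = 1 - D ^ 2 / 2 := by linarith
    have h2 : S * D ^ 2 = (S * D) * D := by ring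
    have h3 : S ^ 2 * D / 2 = S / 2 * (S * D) := by ring
    rw [h2, h3, h1]; ring
  have hE1 : D - D ^ 3 / 6 + S / 2 * (1 - D ^ 2 / 2) ≤ 1 + S / 2 := by
    have h1 : D - D ^ 3 / 6 ≤ 1 := by
      have h2 : 0 ≤ (D + 2.8) * (D - 1.4) ^ 2 := by positivity
      have h3 : (D + 2.8) * (D - 1.4) ^ 2 = D ^ 3 - 5.88 * D + 5.488 := by ring
      rw [h3] at h2
      linarith
    have h4 : 0 < S * D ^ 2 := mul_pos hS0 (pow_pos hD 2)
    have h5 : S / 2 * (1 - D ^ 2 / 2) = S / 2 - S * D ^ 2 / 4 := by ring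
    rw [h5]
    linarith
  -- Step 3
  have hS4 : S ^ 4 ≤ 8 * ε * (1 + S / 2) := by
    have h1 := hA Y hYD hYH.le
    have h2 := hseg 0 Y le_rfl (by linarith) hYH.le
    rw [hpoly, ← hYε] at h1
    have h3 : ε * (Y - D) ^ 2 / 2 ≤ 1 + S / 2 := by
      have e : ε * (Y - D) ^ 2 / 2 = ε * Y * Y - ε * Y ^ 2 / 2 - (ε * Y * D - ε * D ^ 2 / 2) := by
        ring
      rw [e]; linarith
    have h4 : ε * (Y - D) ^ 2 / 2 = S ^ 4 / (8 * ε) := by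
      rw [hY]; field_simp; ring
    rw [h4, div_le_iff₀ (by positivity)] at h3
    linarith
  have hSs : S ≤ 0.002 := by
    by_contra hcon
    push Not at hcon
    have h1 : (0.002 : ℝ) ^ 3 < S ^ 3 := pow_lt_pow_left₀ hcon (by norm_num) (by norm_num)
    have h2 : S ^ 4 = S ^ 3 * S := by ring
    rw [h2] at hS4
    have h3 : 8 * ε * (1 + S / 2) ≤ 8 * 0.000000000001 * (1 + S / 2) := by gcongr
    have h4 : (0.002 : ℝ) ^ 3 * S ≤ S ^ 3 * S := mul_le_mul_of_nonneg_right h1.le hS0.le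
    norm_num at h3 h4
    linarith
  have hDge : 1.41 < D := by
    by_contra hcon
    push Not at hcon
    have h1 := mul_le_mul hSs hcon hD.le (by norm_num)
    have h2 := pow_le_pow_left₀ hD.le hcon 2
    norm_num at h1 h2
    linarith
  -- Step 4
  have hgB : ∀ y, 0 ≤ y → y ≤ 1.2 → (1 - 10 * S) * y ^ 2 / 2 ≤ g y := by
    intro y hy0 hy1
    have hd : ∀ t, HasDerivAt (fun t => g t - (1 - 10 * S) * t ^ 2 / 2)
        (g' t - (1 - 10 * S) * t) t := by
      intro t
      have := (hg t).sub ((((hasDerivAt_id t).pow 2).const_mul (1 - 10 * S)).div_const 2)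
      exact this.congr_deriv (by simp; ring)
    have hm : MonotoneOn (fun t => g t - (1 - 10 * S) * t ^ 2 / 2) (Icc 0 1.2) := by
      apply monotoneOn_of_deriv_nonneg (convex_Icc _ _)
      · exact fun t ht => (hd t).continuousAt.continuousWithinAt
      · exact fun t ht => (hd t).differentiableAt.differentiableWithinAt
      · intro t ht
        have ht' := interior_subset ht
        rw [(hd t).deriv]
        have h1 := hB t ht'.1 (by linarith [ht'.2])
        have h2 : 2 * S * t / (D - t) ≤ 10 * S * t := by
          have h3 : (0.2:ℝ) ≤ D - t := by linarith [ht'.2]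
          rw [div_le_iff₀ (by linarith)]
          have h4 : 0 ≤ S * t := mul_nonneg hS0.le ht'.1
          have h5 := mul_le_mul_of_nonneg_left h3 h4
          linarith
        linarith
    have := hm (left_mem_Icc.mpr (by norm_num)) ⟨hy0, hy1⟩ hy0
    simp only [g0] at this
    linarith
  have hH6 : H ≤ 6 := by
    have h1 := hgB 1.2 (by norm_num) le_rfl
    have h2 : 0.7 ≤ g 1.2 := by norm_num at h1 hSs ⊢; linarith
    have h3 := hseg 0 1.2 le_rfl (by norm_num) (by linarith)
    have h4 : ∫ y in (1.2:ℝ)..H, (0.7:ℝ) ≤ ∫ y in (1.2:ℝ)..H, ((g' y) ^ 2 / 2 + g y) := by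
      apply intervalIntegral.integral_mono_on (by linarith)
      · exact Continuous.intervalIntegrable (by fun_prop) _ _
      · exact Continuous.intervalIntegrable (by fun_prop) _ _
      · intro y hy
        have := hgm (show (1.2:ℝ) ∈ Icc 0 H from ⟨by norm_num, by linarith⟩)
          ⟨by linarith [hy.1], hy.2⟩ hy.1
        have := sq_nonneg (g' y)
        linarith
    rw [intervalIntegral.integral_const, smul_eq_mul] at h4
    have h5 := hsplit 1.2 H
    rw [hpoly, ← hYε] at hAH
    rw [← hYε] at hQ1
    have h6 : ε * (H - Y) * (H - Y) ≤ 1 * (H - Y) :=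
      mul_le_mul_of_nonneg_right (by linarith) (by linarith)
    have h7 := mul_nonneg hε.le (sq_nonneg (Y - D))
    have e : ε * Y * D - ε * D ^ 2 / 2 - (ε * Y * H - ε * H ^ 2 / 2) =
      ε * (H - Y) * (H - Y) / 2 - ε * (Y - D) ^ 2 / 2 := by ring
    linarith
  -- Step 5
  obtain ⟨Q, hQ⟩ : ∃ Q, Q = ε * (H - Y) := ⟨_, rfl⟩
  have hQ0 : 0 ≤ Q := by rw [hQ]; exact mul_nonneg hε.le (by linarith)
  have hC' : ∀ y ∈ Icc 0 H, g y - Q ≤ (g' y) ^ 2 / 2 := by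
    intro y hy
    have := hC (by linarith) y hy
    rw [← hYε] at this
    rw [hQ]; linarith
  have hQ6 : Q ≤ 6 * ε := by
    rw [hQ, mul_comm]
    exact mul_le_mul_of_nonneg_right (by linarith) hε.le
  have hqD : q - D ≤ S := by
    have h1 : q ^ 2 ≤ (D + S) ^ 2 := by
      have e : (D + S) ^ 2 = 2 * (D ^ 2 / 2 + S * D) + S ^ 2 := by ring
      rw [e, hSD, hq2]
      have := sq_nonneg S
      linarith
    have := le_of_sq_le_sq' h1 (by linarith)
    linarith
  have hX1 := growth2 hg hp gH hC' one_pos (by linarith) hQ0 hS0.le hq hq2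
    (hgB 1 zero_le_one (by norm_num)) (by norm_num at hε1 ⊢; linarith)
  norm_num at hX1
  have hQX : Q ≤ ε * (H - q) + ε * S := by
    rw [hQ, ← mul_add]
    exact mul_le_mul_of_nonneg_left (by linarith) hε.le
  have hX11 : H - q ≤ 11 * S := by
    have : ε * (H - q) ≤ 0.000000000001 * (H - q) := mul_le_mul_of_nonneg_right hε1 (by linarith)
    have : ε * S ≤ 0.000000000001 * S := mul_le_mul_of_nonneg_right hε1 hS0.le
    norm_num at *
    linarith
  have hS24 : S ≤ 24 * ε := by
    have h1 : S ^ 2 / (2 * ε) ≤ 12 * S := by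
      rw [hY] at hYH; linarith
    rw [div_le_iff₀ (by positivity)] at h1
    have h2 : S * S ≤ 24 * ε * S := by
      have e1 : S * S = S ^ 2 := by ring
      rw [e1]; linarith
    exact le_of_mul_le_mul_right h2 hS0
  have hX264 : H - q ≤ 264 * ε := by linarith
  have hQ288 : Q ≤ 288 * ε * ε := by
    have h1 := mul_le_mul_of_nonneg_left hX264 hε.le
    have h2 := mul_le_mul_of_nonneg_left hS24 hε.le
    linarith
  obtain ⟨r, hr⟩ : ∃ r, r = √ε := ⟨_, rfl⟩
  have hr0 : 0 < r := by rw [hr]; exact sqrt_pos.mpr hε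
  have hr2 : r ^ 2 = ε := by rw [hr]; exact sq_sqrt hε.le
  have hr6 : r ≤ 0.000001 := by
    rw [hr]; apply sqrt_le_iff.mpr; norm_num at *; exact hε1
  have hXr := growth2 hg hp gH hC' hr0 (by norm_num at hr6; linarith) hQ0 hS0.le hq hq2
    (hgB r hr0.le (by norm_num at hr6 ⊢; linarith)) (by
      rw [hr2]
      have h1 : 10 * S * ε ≤ 240 * ε * ε := mul_le_mul_of_nonneg_right (by linarith) hε.le
      have h2 : ε * ε ≤ 0.000000000001 * ε := mul_le_mul_of_nonneg_right hε1 hε.le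
      norm_num at h2
      linarith)
  have hXf : H - q ≤ 0.001 * ε := by
    have h1 : 2 * Q / r ≤ 576 * r * ε := by
      rw [div_le_iff₀ hr0]
      have : 576 * r * ε * r = 576 * ε * r ^ 2 := by ring
      rw [this, hr2]; linarith
    have h2 : 10 * S * r ≤ 240 * ε * r :=
      mul_le_mul_of_nonneg_right (by linarith) hr0.le
    have h3 : 816 * (r * ε) ≤ 816 * (0.000001 * ε) := by gcongr
    norm_num at h3 ⊢
    linarith
  -- Step 6
  have L2 := sqrt_two_lower (ε := ε) hS0 hD hq hq2 hSD
  have hqle : q ≤ 1.4143 := le_of_sq_le_sq' (by rw [hq2]; norm_num) (by norm_num)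
  have h8 : 8 * ε ≤ D * (12 * S + 2 * S * D ^ 2 - 12 * ε * q * D) := by
    have h1 : q * D ≤ 2 := by
      have := sq_nonneg (q - D)
      have e : (q - D) ^ 2 = q ^ 2 - 2 * (q * D) + D ^ 2 := by ring
      rw [e] at this
      linarith
    have h2 : (1.98:ℝ) ≤ D ^ 2 := by
      have := pow_le_pow_left₀ (by norm_num) hDge.le 2
      norm_num at this ⊢
      linarith
    have h3 : S * 1.98 ≤ S * D ^ 2 := mul_le_mul_of_nonneg_left h2 hS0.le
    have h4 : ε * (q * D) ≤ ε * 2 := mul_le_mul_of_nonneg_left h1 hε.le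
    have h5 : 6 * ε ≤ 12 * S + 2 * S * D ^ 2 - 12 * ε * q * D := by
      have e : 12 * ε * q * D = 12 * (ε * (q * D)) := by ring
      rw [e]; linarith
    have h6 := mul_le_mul hDge.le h5 (by positivity) hD.le
    linarith
  have hfin : H * D ^ 2 * (H + 2 * D) + 12 * ε * H * D ^ 2 - (q * D ^ 2 * (q + 2 * D)
      + 12 * ε * q * D ^ 2) ≤ 25 * (H - q) := by
    have e : H * D ^ 2 * (H + 2 * D) + 12 * ε * H * D ^ 2 - (q * D ^ 2 * (q + 2 * D)
      + 12 * ε * q * D ^ 2) = (D ^ 2 * (H + q + 2 * D + 12 * ε)) * (H - q) := by ring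
    rw [e]
    apply mul_le_mul_of_nonneg_right _ (by linarith)
    have h1 : H + q + 2 * D + 12 * ε ≤ 12 := by norm_num at hε1; linarith
    have h2 : D ^ 2 * (H + q + 2 * D + 12 * ε) ≤ 2 * 12 := by
      apply mul_le_mul hD2.le h1 (by positivity) (by norm_num)
    linarith
  linarith

end oneD

namespace Wv
variable {ε S D : ℝ} {u : ℝ × ℝ → ℝ} {η : ℝ → ℝ}

lemma contradiction (W : Wv ε S D u η) (hε1 : ε ≤ 0.000000000001) (hS : 1.9 * ε ≤ S) : False := by
  refine endgame (g := fun y => u (0, y)) (g' := fun y => Dy u (0, y)) (H := η 0) (q := √2)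
    (fun y => hasDerivAt_y W.u_diff 0 y) (by have := W.Dy_cont; fun_prop) W.eps hε1 hS W.Dpos W.SD
    (by positivity) (by norm_num) (W.eta_gt 0) (fun y hy => W.Dy_nonneg hy.1 hy.2) (W.bot 0)
    (W.surf 0) (fun b h1 h2 => W.factA h1 h2) (fun y h0 h1 => W.factB h0 h1) ?_ ?_
  · intro h y hy
    have := W.factC h hy.1 hy.2
    unfold PF at this
    rw [W.Dx_zero] at this
    linarith
  · have := W.bern 0
    nlinarith [sq_nonneg (Dx u (0, η 0)), sq_nonneg (Dy u (0, η 0))]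

end Wv

lemma px_eq {ψ : ℝ → ℝ → ℝ} (h : ContDiff ℝ (⊤ : ℕ∞) (fun p : ℝ × ℝ => ψ p.1 p.2)) (x y : ℝ) :
    px ψ x y = Dx (fun p : ℝ × ℝ => ψ p.1 p.2) (x, y) :=
  (hasDerivAt_x (smooth_diff h) x y).deriv

lemma py_eq {ψ : ℝ → ℝ → ℝ} (h : ContDiff ℝ (⊤ : ℕ∞) (fun p : ℝ × ℝ => ψ p.1 p.2)) (x y : ℝ) :
    py ψ x y = Dy (fun p : ℝ × ℝ => ψ p.1 p.2) (x, y) :=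
  (hasDerivAt_y (smooth_diff h) x y).deriv

lemma pxx_eq {ψ : ℝ → ℝ → ℝ} (h : ContDiff ℝ (⊤ : ℕ∞) (fun p : ℝ × ℝ => ψ p.1 p.2)) (x y : ℝ) :
    pxx ψ x y = Dx (Dx (fun p : ℝ × ℝ => ψ p.1 p.2)) (x, y) := by
  unfold pxx
  simp only [px_eq h]
  exact (hasDerivAt_x (smooth_diff (Dx_smooth h)) x y).deriv

lemma pyy_eq {ψ : ℝ → ℝ → ℝ} (h : ContDiff ℝ (⊤ : ℕ∞) (fun p : ℝ × ℝ => ψ p.1 p.2)) (x y : ℝ) :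
    pyy ψ x y = Dy (Dy (fun p : ℝ × ℝ => ψ p.1 p.2)) (x, y) := by
  unfold pyy
  simp only [py_eq h]
  exact (hasDerivAt_y (smooth_diff (Dy_smooth h)) x y).deriv

lemma scale_smooth {v : ℝ × ℝ → ℝ} (h : ContDiff ℝ (⊤ : ℕ∞) v) (L : ℝ) :
    ContDiff ℝ (⊤ : ℕ∞) (fun p : ℝ × ℝ => v (L * p.1, L * p.2)) :=
  h.comp ((contDiff_const.mul contDiff_fst).prodMk (contDiff_const.mul contDiff_snd))

lemma hasDerivAt_Lmul (L t : ℝ) : HasDerivAt (fun t => L * t) L t := by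
  simpa using (hasDerivAt_id t).const_mul L

lemma Dx_scale {v : ℝ × ℝ → ℝ} (h : ContDiff ℝ (⊤ : ℕ∞) v) (L : ℝ) :
    Dx (fun p : ℝ × ℝ => v (L * p.1, L * p.2)) = fun p => L * Dx v (L * p.1, L * p.2) := by
  funext p
  obtain ⟨x, y⟩ := p
  apply Dx_of_hasDerivAt (smooth_diff (scale_smooth h L))
  exact (hasDerivAt_curve (smooth_diff h) (hasDerivAt_Lmul L x)
    (hasDerivAt_const x (L * y))).congr_deriv (by ring)

lemma Dy_scale {v : ℝ × ℝ → ℝ} (h : ContDiff ℝ (⊤ : ℕ∞) v) (L : ℝ) :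
    Dy (fun p : ℝ × ℝ => v (L * p.1, L * p.2)) = fun p => L * Dy v (L * p.1, L * p.2) := by
  funext p
  obtain ⟨x, y⟩ := p
  apply Dy_of_hasDerivAt (smooth_diff (scale_smooth h L))
  exact (hasDerivAt_curve (smooth_diff h) (hasDerivAt_const y (L * x))
    (hasDerivAt_Lmul L y)).congr_deriv (by ring)

lemma Dxx_scale {v : ℝ × ℝ → ℝ} (h : ContDiff ℝ (⊤ : ℕ∞) v) (L x y : ℝ) :
    Dx (Dx (fun p : ℝ × ℝ => v (L * p.1, L * p.2))) (x, y) =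
      L ^ 2 * Dx (Dx v) (L * x, L * y) := by
  have hs := Dx_smooth (scale_smooth h L)
  apply Dx_of_hasDerivAt (smooth_diff hs)
  rw [Dx_scale h L]
  exact ((hasDerivAt_curve (smooth_diff (Dx_smooth h)) (hasDerivAt_Lmul L x)
    (hasDerivAt_const x (L * y))).const_mul L).congr_deriv (by ring)

lemma Dyy_scale {v : ℝ × ℝ → ℝ} (h : ContDiff ℝ (⊤ : ℕ∞) v) (L x y : ℝ) :
    Dy (Dy (fun p : ℝ × ℝ => v (L * p.1, L * p.2))) (x, y) =
      L ^ 2 * Dy (Dy v) (L * x, L * y) := by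
  have hs := Dy_smooth (scale_smooth h L)
  apply Dy_of_hasDerivAt (smooth_diff hs)
  rw [Dy_scale h L]
  exact ((hasDerivAt_curve (smooth_diff (Dy_smooth h)) (hasDerivAt_const y (L * x))
    (hasDerivAt_Lmul L y)).const_mul L).congr_deriv (by ring)

lemma lamDepth_eq {γ s : ℝ} (hγ : 0 < γ) : γ * (lamDepth γ s) ^ 2 / 2 + s * lamDepth γ s = 1 := by
  unfold lamDepth
  have h := sq_sqrt (show 0 ≤ s ^ 2 + 2 * γ by positivity)
  generalize √(s ^ 2 + 2 * γ) = w at h ⊢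
  field_simp
  nlinarith

lemma lamDepth_pos {γ s : ℝ} (hγ : 0 < γ) : 0 < lamDepth γ s := by
  unfold lamDepth
  apply div_pos _ hγ
  have : |s| < √(s ^ 2 + 2 * γ) := by
    rw [← sqrt_sq_eq_abs]
    exact sqrt_lt_sqrt (sq_nonneg s) (by linarith)
  linarith [le_abs_self s]

lemma rescale {γ s r L : ℝ} {ψ : ℝ → ℝ → ℝ} {η : ℝ → ℝ} (hγ : 0 < γ) (hs : 0 < s)
    (hL : 0 < L) (hL2 : L ^ 2 * γ = 1)
    (hsol : StreamSolution γ ψ η r)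
    (heven : ∀ x, η (-x) = η x) (hpe : ∀ x y, ψ (-x) y = ψ x y)
    (hanti : StrictAntiOn η (Set.Ioi 0)) (huni : Unidirectional ψ η) (hr : bernR γ s = r)
    (hasy : ∀ ε > 0, ∃ X : ℝ, ∀ x : ℝ, X ≤ |x| →
      |η x - lamDepth γ s| ≤ ε ∧
      ∀ y ∈ Set.Icc 0 (η x), |px ψ x y| + |py ψ x y - (γ * y + s)| ≤ ε) :
    Wv (L ^ 3) (s * L) (lamDepth γ s / L) (fun p => ψ (L * p.1) (L * p.2))
      (fun x => η (L * x) / L) := by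
  have hv := hsol.psi_smooth
  have hγL : γ = 1 / L ^ 2 := by field_simp; linarith
  have sc := Dx_scale hv L
  have sc' := Dy_scale hv L
  have hdx : ∀ x y, Dx (fun p : ℝ × ℝ => ψ (L * p.1) (L * p.2)) (x, y) =
      L * px ψ (L * x) (L * y) := by
    intro x y; rw [px_eq hv]; exact congrFun sc (x, y)
  have hdy : ∀ x y, Dy (fun p : ℝ × ℝ => ψ (L * p.1) (L * p.2)) (x, y) =
      L * py ψ (L * x) (L * y) := by
    intro x y; rw [py_eq hv]; exact congrFun sc' (x, y)
  have hLη : ∀ x, L * (η (L * x) / L) = η (L * x) := by intro x; field_simp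
  have hlt : ∀ x y, y < η (L * x) / L → L * y < η (L * x) := by
    intro x y h
    rw [lt_div_iff₀ hL] at h
    linarith
  refine ⟨by positivity, by positivity, div_pos (lamDepth_pos hγ) hL, ?_, ?_, ?_, ?_, ?_, ?_, ?_,
    ?_, ?_, ?_, ?_, ?_, ?_⟩
  · have h := lamDepth_eq (s := s) hγ
    have e1 : s * L * (lamDepth γ s / L) = s * lamDepth γ s := by field_simp
    have e2 : (lamDepth γ s / L) ^ 2 = γ * lamDepth γ s ^ 2 := by
      rw [div_pow, div_eq_iff (by positivity)]
      calc _ = lamDepth γ s ^ 2 * (L ^ 2 * γ) := by rw [hL2, mul_one]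
        _ = _ := by ring
    rw [e1, e2]; exact h
  · exact (hsol.eta_smooth.comp (contDiff_const.mul contDiff_id)).div_const L
  · exact fun x => div_pos (hsol.eta_pos _) hL
  · exact scale_smooth hv L
  · intro x y h0 h1
    have h := hsol.laplace (L * x) (L * y) (by positivity) (hlt x y h1)
    rw [pxx_eq hv, pyy_eq hv] at h
    have e1 := Dxx_scale hv L x y
    have e2 := Dyy_scale hv L x y
    simp only at e1 e2
    rw [e1, e2, ← mul_add, h, hL2]
  · intro x
    have h := hsol.bernoulli (L * x)
    rw [hdx, hdy, hLη]
    rw [← hr] at h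
    unfold bernR at h
    have e1 : L ^ 3 * (η (L * x) / L) = L ^ 2 * η (L * x) := by field_simp
    have e2 : L ^ 3 * (lamDepth γ s / L) = L ^ 2 * lamDepth γ s := by field_simp
    rw [e1, e2, ← hL2]
    linear_combination L ^ 2 * h
  · intro x
    simp only [hLη]
    exact hsol.surface_val _
  · intro x
    simp only [mul_zero]
    exact hsol.bottom_val _
  · intro x
    simp only [mul_neg, heven]
  · intro x y
    simp only [mul_neg, hpe]
  · intro a ha b hb hab
    simp only [mem_Ioi] at ha hb
    have := hanti (show L * a ∈ Ioi 0 from mul_pos hL ha) (show L * b ∈ Ioi 0 from mul_pos hL hb)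
      (mul_lt_mul_of_pos_left hab hL)
    exact div_lt_div_of_pos_right this hL
  · intro x y h0 h1
    rw [hdy]
    exact mul_pos hL (huni _ _ (mul_pos hL h0) (hlt x y h1))
  · intro e he
    obtain ⟨X, hX⟩ := hasy (min (L * e) (e / L)) (by positivity)
    refine ⟨X / L, fun x hx => ?_⟩
    have hx' : X ≤ |L * x| := by
      rw [abs_mul, abs_of_pos hL]
      rw [div_le_iff₀ hL] at hx
      linarith
    obtain ⟨h1, h2⟩ := hX (L * x) hx'
    constructor
    · rw [← sub_div, abs_div, abs_of_pos hL, div_le_iff₀ hL]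
      linarith [min_le_left (L * e) (e / L)]
    · intro y hy
      have h3 := h2 (L * y) ⟨mul_nonneg hL.le hy.1, by
        have := hy.2
        rw [le_div_iff₀ hL] at this
        linarith⟩
      have h4 := h3.trans (min_le_right _ _)
      rw [le_div_iff₀ hL] at h4
      rw [hdx, hdy]
      have e1 : L * py ψ (L * x) (L * y) - (y + s * L) =
          L * (py ψ (L * x) (L * y) - (γ * (L * y) + s)) := by
        have : L * (γ * (L * y)) = y := by
          calc _ = L ^ 2 * γ * y := by ring
            _ = y := by rw [hL2, one_mul]
        linear_combination this
      rw [e1, abs_mul, abs_mul, abs_of_pos hL]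
      linarith

lemma bernR_tangent {γ : ℝ} (hγ : 0 < γ) (s t : ℝ) :
    bernR γ s + (t - s) * (s - 1 / γ + s / (γ * √(s ^ 2 + 2 * γ))) + (t - s) ^ 2 / 2
      ≤ bernR γ t := by
  have hs : 0 < √(s ^ 2 + 2 * γ) := sqrt_pos.mpr (by positivity)
  have hs2 := sq_sqrt (show 0 ≤ s ^ 2 + 2 * γ by positivity)
  have ht2 := sq_sqrt (show 0 ≤ t ^ 2 + 2 * γ by positivity)
  have ht : 0 < √(t ^ 2 + 2 * γ) := sqrt_pos.mpr (by positivity)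
  unfold bernR lamDepth
  set a := √(s ^ 2 + 2 * γ)
  set b := √(t ^ 2 + 2 * γ)
  have h1 : t * s + 2 * γ ≤ b * a := by
    apply le_of_sq_le_sq' _ (by positivity)
    rw [mul_pow, hs2, ht2]
    nlinarith [mul_nonneg hγ.le (sq_nonneg (t - s))]
  have h2 : a + (t - s) * s / a ≤ b := by
    have : a + (t - s) * s / a = (t * s + 2 * γ) / a := by
      field_simp; rw [hs2]; ring
    rw [this, div_le_iff₀ hs]; exact h1
  have h3 : (a + (t - s) * s / a) / γ ≤ b / γ := div_le_div_of_nonneg_right h2 hγ.le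
  have e : (a + (t - s) * s / a) / γ = a / γ + (t - s) * (s / (γ * a)) := by
    field_simp
  rw [e] at h3
  have e2 : (-t + b) / γ = -t * (1 / γ) + b / γ := by ring
  have e3 : (-s + a) / γ = -s * (1 / γ) + a / γ := by ring
  rw [e2, e3]
  nlinarith

lemma Rstar_lt {γ : ℝ} (hγ : 100 < γ) : bernR γ (1.9 / γ) < bernR γ 0 := by
  have hγ0 : 0 < γ := by linarith
  unfold bernR lamDepth
  have hw : 1 ≤ √(0 ^ 2 + 2 * γ) := by
    rw [one_le_sqrt]; linarith
  have hw2 := sq_sqrt (show 0 ≤ (0:ℝ) ^ 2 + 2 * γ by positivity)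
  set w := √(0 ^ 2 + 2 * γ)
  set t := 1.9 / γ with ht
  have ht0 : 0 < t := by positivity
  have h1 : √(t ^ 2 + 2 * γ) ≤ w + t ^ 2 / 2 := by
    apply sqrt_le_iff.mpr ⟨by positivity, _⟩
    nlinarith [sq_nonneg (t ^ 2), mul_nonneg (sub_nonneg.mpr hw) (sq_nonneg t)]
  have h2 : √(t ^ 2 + 2 * γ) / γ ≤ (w + t ^ 2 / 2) / γ := div_le_div_of_nonneg_right h1 hγ0.le
  have e1 : (-t + √(t ^ 2 + 2 * γ)) / γ = -t / γ + √(t ^ 2 + 2 * γ) / γ := by ring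
  have e2 : (-0 + w) / γ = w / γ := by ring
  have e3 : (w + t ^ 2 / 2) / γ = w / γ + t ^ 2 / 2 / γ := by ring
  rw [e1, e2]
  rw [e3] at h2
  have h4 : t ^ 2 / 2 - t / γ + t ^ 2 / 2 / γ < 0 := by
    have : t ^ 2 / 2 - t / γ + t ^ 2 / 2 / γ = (1.805 / γ - 0.095) / γ ^ 2 := by
      rw [ht]; field_simp; ring
    rw [this]
    apply div_neg_of_neg_of_pos _ (by positivity)
    rw [sub_neg, div_lt_iff₀ hγ0]
    linarith
  have e4 : -t / γ = -(t / γ) := by ring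
  rw [e4]
  linarith

/-- Theorem 5.1: for large `γ` there exists `R* ∈ (R(s_c), R(0))` such that every
unidirectional solitary wave has Bernoulli constant `r ∈ (R(s_c), R*)`. -/
theorem solitary_bernoulli_bound :
    ∃ γ₀ > (0 : ℝ), ∀ γ > γ₀, ∀ sc : ℝ, IsCrit γ sc →
      ∃ Rstar : ℝ, bernR γ sc < Rstar ∧ Rstar < bernR γ 0 ∧
        ∀ (ψ : ℝ → ℝ → ℝ) (η : ℝ → ℝ) (r : ℝ),
          SolitaryWave γ sc ψ η r → Unidirectional ψ η →
          bernR γ sc < r ∧ r < Rstar := by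
  refine ⟨100000000, by norm_num, fun γ hγ sc hsc => ?_⟩
  have hγ0 : 0 < γ := by linarith
  obtain ⟨hsc0, hcrit⟩ := hsc
  have hmin : ∀ t, t ≠ sc → bernR γ sc < bernR γ t := by
    intro t ht
    have h := bernR_tangent hγ0 sc t
    rw [hcrit, mul_zero, add_zero] at h
    have : 0 < (t - sc) ^ 2 := by
      have := sub_ne_zero.mpr ht
      positivity
    linarith
  have hsclt : sc < 1 / γ := by
    have : 0 < sc / (γ * √(sc ^ 2 + 2 * γ)) := by
      have : 0 < √(sc ^ 2 + 2 * γ) := sqrt_pos.mpr (by positivity)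
      positivity
    linarith
  have h19 : 1 / γ < 1.9 / γ := div_lt_div_of_pos_right (by norm_num) hγ0
  refine ⟨bernR γ (1.9 / γ), hmin _ (by linarith), Rstar_lt (by linarith), ?_⟩
  intro ψ η r hW hU
  obtain ⟨s, hs, hr, hasy⟩ := hW.asymptotic
  have hs0 : 0 < s := hsc0.trans hs
  have hmins := hmin s (by linarith)
  refine ⟨by rw [← hr]; exact hmins, ?_⟩
  by_contra hcon
  push Not at hcon
  have hsge : 1.9 / γ ≤ s := by
    by_contra hlt
    push Not at hlt
    have h1 := bernR_tangent hγ0 s sc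
    have h2 := bernR_tangent hγ0 s (1.9 / γ)
    rw [hr] at h1 h2 hmins
    set R' := s - 1 / γ + s / (γ * √(s ^ 2 + 2 * γ))
    have h3 : 0 < R' := by
      by_contra hn
      push Not at hn
      have := mul_nonneg_of_nonpos_of_nonpos (show sc - s ≤ 0 by linarith) hn
      have := sq_nonneg (sc - s)
      linarith
    have h4 := mul_pos (sub_pos.mpr hlt) h3
    have := sq_nonneg (1.9 / γ - s)
    linarith
  set L := 1 / √γ with hLd
  have hsq : 0 < √γ := sqrt_pos.mpr hγ0
  have hL : 0 < L := by positivity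
  have hL2' : L ^ 2 = 1 / γ := by rw [hLd, div_pow, one_pow, sq_sqrt hγ0.le]
  have hL2 : L ^ 2 * γ = 1 := by rw [hL2']; field_simp
  have W := rescale hγ0 hs0 hL hL2 hW.sol hW.eta_even hW.psi_even hW.eta_anti hU hr hasy
  have hL4 : L ≤ 0.0001 := by
    rw [hLd, div_le_iff₀ hsq]
    have : (10000:ℝ) ≤ √γ := by
      apply le_sqrt_of_sq_le
      norm_num
      linarith
    norm_num
    linarith
  refine W.contradiction ?_ ?_
  · calc L ^ 3 ≤ (0.0001) ^ 3 := pow_le_pow_left₀ hL.le hL4 3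
      _ ≤ 0.000000000001 := by norm_num
  · have : 1.9 * L ^ 3 = (1.9 / γ) * L := by
      rw [pow_succ, hL2']; ring
    rw [this]
    exact mul_le_mul_of_nonneg_right hsge hL.le
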